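/- Suppose 3 ≤ l ≤ n−1, 1 ≤ i ≤ j ≤ l and 1 ≤ g ≤ h ≤ l−2 with i ≤ g, and let p, r ∈ P. Then α_{ijl}^p·α_{g,h,l−2}^r ∈ ⟨α_{i'j'l}^{p'}·α_{g'h'l−2}^{r'}·b : i' > i, 1 ≤ i' ≤ j' ≤ l, 1 ≤ g' ≤ h' ≤ l−2, p', r' ∈ P, b ∈ B_{l−3}⟩. -/

import Mathlib

/-!
Cyclotomic BMW algebra `B_n^k(R)`, presented as the quotient of the free `R`-algebra on
generators `Y, Y⁻¹, Xᵢ, Xᵢ⁻¹ (1 ≤ i ≤ n-1), eᵢ (1 ≤ i ≤ n-1)` by the defining relations.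
Generators with out-of-range indices are identified with `1` (resp. `0` for the `eᵢ`),
so that the quotient is exactly the cyclotomic BMW algebra.
-/

inductive BMWGen : Type
  | Y : BMWGen
  | Yinv : BMWGen
  | X : ℕ → BMWGen
  | Xinv : ℕ → BMWGen
  | E : ℕ → BMWGen

namespace CBMW

/-- The parameters of a cyclotomic BMW algebra: `n`, `k`, units `q, λ, q₀` and
families `qc` (the `qᵢ`, with `qc 0 = q₀`) and `A` (the `Aᵢ`). -/
structure Params (R : Type) [CommRing R] where
  n : ℕ
  k : ℕ
  q : Rˣ
  lam : Rˣ
  q0 : Rˣ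
  qc : ℕ → R
  A : ℕ → R

variable {R : Type} [CommRing R]

abbrev F (R : Type) [CommRing R] := FreeAlgebra R BMWGen

def fY : F R := FreeAlgebra.ι R BMWGen.Y
def fYi : F R := FreeAlgebra.ι R BMWGen.Yinv
def fX (i : ℕ) : F R := FreeAlgebra.ι R (BMWGen.X i)
def fXi (i : ℕ) : F R := FreeAlgebra.ι R (BMWGen.Xinv i)
def fE (i : ℕ) : F R := FreeAlgebra.ι R (BMWGen.E i)

/-- `δ = q - q⁻¹`. -/
def Params.delta (P : Params R) : R := (P.q : R) - ((P.q⁻¹ : Rˣ) : R)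

/-- `λ⁻¹` as an element of `R`. -/
def Params.laminv (P : Params R) : R := ((P.lam⁻¹ : Rˣ) : R)

/-- The defining relations of the cyclotomic BMW algebra. -/
inductive Rel (P : Params R) : F R → F R → Prop
  | X_inv_right {i : ℕ} (h1 : 1 ≤ i) (h2 : i ≤ P.n - 1) : Rel P (fX i * fXi i) 1
  | X_inv_left {i : ℕ} (h1 : 1 ≤ i) (h2 : i ≤ P.n - 1) : Rel P (fXi i * fX i) 1
  | Y_inv_right : Rel P (fY * fYi) 1
  | Y_inv_left : Rel P (fYi * fY) 1
  | X_invalid {i : ℕ} (h : i = 0 ∨ P.n - 1 < i) : Rel P (fX i) 1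
  | Xi_invalid {i : ℕ} (h : i = 0 ∨ P.n - 1 < i) : Rel P (fXi i) 1
  | E_invalid {i : ℕ} (h : i = 0 ∨ P.n - 1 < i) : Rel P (fE i) 0
  | skein {i : ℕ} (h1 : 1 ≤ i) (h2 : i ≤ P.n - 1) :
      Rel P (fX i - fXi i) (P.delta • ((1 : F R) - fE i))
  | XX_far {i j : ℕ} (h1 : 1 ≤ i) (h2 : i ≤ P.n - 1) (h3 : 1 ≤ j) (h4 : j ≤ P.n - 1)
      (h : i + 2 ≤ j ∨ j + 2 ≤ i) : Rel P (fX i * fX j) (fX j * fX i)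
  | braid {i : ℕ} (h1 : 1 ≤ i) (h2 : i + 1 ≤ P.n - 1) :
      Rel P (fX i * fX (i+1) * fX i) (fX (i+1) * fX i * fX (i+1))
  | XE_far {i j : ℕ} (h1 : 1 ≤ i) (h2 : i ≤ P.n - 1) (h3 : 1 ≤ j) (h4 : j ≤ P.n - 1)
      (h : i + 2 ≤ j ∨ j + 2 ≤ i) : Rel P (fX i * fE j) (fE j * fX i)
  | EE_far {i j : ℕ} (h1 : 1 ≤ i) (h2 : i ≤ P.n - 1) (h3 : 1 ≤ j) (h4 : j ≤ P.n - 1)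
      (h : i + 2 ≤ j ∨ j + 2 ≤ i) : Rel P (fE i * fE j) (fE j * fE i)
  | untwist_right {i : ℕ} (h1 : 1 ≤ i) (h2 : i ≤ P.n - 1) :
      Rel P (fX i * fE i) ((P.lam : R) • fE i)
  | untwist_left {i : ℕ} (h1 : 1 ≤ i) (h2 : i ≤ P.n - 1) :
      Rel P (fE i * fX i) ((P.lam : R) • fE i)
  | XXE {i j : ℕ} (h1 : 1 ≤ i) (h2 : i ≤ P.n - 1) (h3 : 1 ≤ j) (h4 : j ≤ P.n - 1)
      (h : j = i + 1 ∨ i = j + 1) : Rel P (fX i * fX j * fE i) (fE j * fE i)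
  | EXX {i j : ℕ} (h1 : 1 ≤ i) (h2 : i ≤ P.n - 1) (h3 : 1 ≤ j) (h4 : j ≤ P.n - 1)
      (h : j = i + 1 ∨ i = j + 1) : Rel P (fE j * fE i) (fE j * fX i * fX j)
  | EEE_up {i : ℕ} (h1 : 1 ≤ i) (h2 : i + 1 ≤ P.n - 1) :
      Rel P (fE i * fE (i+1) * fE i) (fE i)
  | EEE_down {i : ℕ} (h1 : 1 ≤ i) (h2 : i + 1 ≤ P.n - 1) :
      Rel P (fE (i+1) * fE i * fE (i+1)) (fE (i+1))
  | E_sq {i : ℕ} (h1 : 1 ≤ i) (h2 : i ≤ P.n - 1) : Rel P (fE i * fE i) (P.A 0 • fE i)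
  | cyclo : Rel P (fY ^ P.k) (∑ i ∈ Finset.range P.k, P.qc i • fY ^ i)
  | braidB (h : 2 ≤ P.n) :
      Rel P (fX 1 * fY * fX 1 * fY) (fY * fX 1 * fY * fX 1)
  | YX_comm {i : ℕ} (h1 : 2 ≤ i) (h2 : i ≤ P.n - 1) : Rel P (fY * fX i) (fX i * fY)
  | YE_comm {i : ℕ} (h1 : 2 ≤ i) (h2 : i ≤ P.n - 1) : Rel P (fY * fE i) (fE i * fY)
  | YXYE (h : 2 ≤ P.n) : Rel P (fY * fX 1 * fY * fE 1) (P.laminv • fE 1)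
  | EYXY (h : 2 ≤ P.n) : Rel P (fE 1 * (fY * fX 1 * fY)) (P.laminv • fE 1)
  | EYE {m : ℕ} (h : 2 ≤ P.n) (hm : m ≤ P.k - 1) :
      Rel P (fE 1 * fY ^ m * fE 1) (P.A m • fE 1)

/-- The cyclotomic BMW algebra `B_n^k(R)`. -/
abbrev Alg (P : Params R) := RingQuot (Rel P)

def pr (P : Params R) : F R →ₐ[R] Alg P := RingQuot.mkAlgHom R (Rel P)

/-- The generator `Y`. -/
def Yg (P : Params R) : Alg P := pr P fY
/-- The generator `Y⁻¹`. -/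
def Ygi (P : Params R) : Alg P := pr P fYi
/-- The generator `Xᵢ`. -/
def Xg (P : Params R) (i : ℕ) : Alg P := pr P (fX i)
/-- The generator `Xᵢ⁻¹`. -/
def Xgi (P : Params R) (i : ℕ) : Alg P := pr P (fXi i)
/-- The generator `eᵢ`. -/
def Eg (P : Params R) (i : ℕ) : Alg P := pr P (fE i)

/-- `X₁ X₂ ⋯ X_m`. -/
def upX (P : Params R) : ℕ → Alg P
  | 0 => 1
  | m + 1 => upX P m * Xg P (m + 1)

/-- `X_m ⋯ X₂ X₁`. -/
def downX (P : Params R) : ℕ → Alg P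
  | 0 => 1
  | m + 1 => Xg P (m + 1) * downX P m

/-- `X₁⁻¹ X₂⁻¹ ⋯ X_m⁻¹`. -/
def upXi (P : Params R) : ℕ → Alg P
  | 0 => 1
  | m + 1 => upXi P m * Xgi P (m + 1)

/-- `X_m⁻¹ ⋯ X₂⁻¹ X₁⁻¹`. -/
def downXi (P : Params R) : ℕ → Alg P
  | 0 => 1
  | m + 1 => Xgi P (m + 1) * downXi P m

/-- `Yᵢ' = X_{i-1} ⋯ X₁ Y X₁ ⋯ X_{i-1}`. -/
def Yp (P : Params R) (i : ℕ) : Alg P := downX P (i - 1) * Yg P * upX P (i - 1)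

/-- `(Yᵢ')⁻¹ = X_{i-1}⁻¹ ⋯ X₁⁻¹ Y⁻¹ X₁⁻¹ ⋯ X_{i-1}⁻¹`. -/
def YpInv (P : Params R) (i : ℕ) : Alg P := downXi P (i - 1) * Ygi P * upXi P (i - 1)

/-- `(Yᵢ')^p` for an integer exponent `p`. -/
def Ypow (P : Params R) (i : ℕ) (p : ℤ) : Alg P :=
  if 0 ≤ p then Yp P i ^ p.toNat else YpInv P i ^ (-p).toNat

/-- `Y^{s 1} (Y₂')^{s 2} ⋯ (Y_m')^{s m}`. -/
def YpowProd (P : Params R) (s : ℕ → ℤ) : ℕ → Alg P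
  | 0 => 1
  | m + 1 => YpowProd P s m * Ypow P (m + 1) (s (m + 1))

/-- The subalgebra `B_l` generated by `Y^{±1}, X₁^{±1}, …, X_{l-1}^{±1}, e₁, …, e_{l-1}`. -/
def Bsub (P : Params R) (l : ℕ) : Subalgebra R (Alg P) :=
  Algebra.adjoin R
    ({Yg P, Ygi P} ∪
      {x | ∃ i, 1 ≤ i ∧ i + 1 ≤ l ∧ (x = Xg P i ∨ x = Xgi P i ∨ x = Eg P i)})

/-- `α_{ijl}^p = (Yᵢ')^p Xᵢ ⋯ X_{j-1} e_j ⋯ e_l`. -/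
def alpha (P : Params R) (i j l : ℕ) (p : ℤ) : Alg P :=
  Ypow P i p * ((List.range' i (j - i)).map fun t => Xg P t).prod *
    ((List.range' j (l + 1 - j)).map fun t => Eg P t).prod

/-- The set `P = {⌊k/2⌋ - (k-1), …, ⌊k/2⌋}` of `k` consecutive integers. -/
def Pset (k : ℕ) : Set ℤ := {p | (↑(k / 2) : ℤ) - ((k : ℤ) - 1) ≤ p ∧ p ≤ (↑(k / 2) : ℤ)}

/-- `α_{i₁,j₁,l-1}^{s₁} ⋯ α_{i_m,j_m,l-2m+1}^{s_m}`. -/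
def alphaChain (P : Params R) (l : ℕ) (ii jj : ℕ → ℕ) (ss : ℕ → ℤ) : ℕ → Alg P
  | 0 => 1
  | m + 1 => alphaChain P l ii jj ss m *
      alpha P (ii (m + 1)) (jj (m + 1)) (l + 1 - 2 * (m + 1)) (ss (m + 1))

/-- `α_{i₁,j₁,l-2}^{s₁} ⋯ α_{i_m,j_m,l-2m}^{s_m}`. -/
def alphaChainBar (P : Params R) (l : ℕ) (ii jj : ℕ → ℕ) (ss : ℕ → ℤ) : ℕ → Alg P
  | 0 => 1
  | m + 1 => alphaChainBar P l ii jj ss m *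
      alpha P (ii (m + 1)) (jj (m + 1)) (l - 2 * (m + 1)) (ss (m + 1))

/-- `E_{l,m} = e_{l-1} e_{l-3} ⋯ e_{l-2m+1}`. -/
def Echain (P : Params R) (l : ℕ) : ℕ → Alg P
  | 0 => 1
  | m + 1 => Echain P l m * Eg P (l + 1 - 2 * (m + 1))

/-- The set `V_{l,m}^g`. -/
def Vg (P : Params R) (l m : ℕ) : Set (Alg P) :=
  {x | ∃ ii jj : ℕ → ℕ, ∃ ss : ℕ → ℤ,
    (∀ t, 1 ≤ t → t ≤ m →
      1 ≤ ii t ∧ ii t ≤ jj t ∧ jj t ≤ l + 1 - 2 * t ∧ ss t ∈ Pset P.k) ∧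
    x = alphaChain P l ii jj ss m}

/-- The set `V_{l,m}`. -/
def V (P : Params R) (l m : ℕ) : Set (Alg P) :=
  {x | ∃ ii jj : ℕ → ℕ, ∃ ss : ℕ → ℤ,
    (∀ t, 1 ≤ t → t ≤ m →
      1 ≤ ii t ∧ ii t ≤ jj t ∧ jj t ≤ l + 1 - 2 * t ∧ ss t ∈ Pset P.k) ∧
    (∀ t, 1 ≤ t → t + 1 ≤ m → ii (t + 1) < ii t) ∧
    x = alphaChain P l ii jj ss m}

/-- The set `V̄_{l,m}`. -/
def Vbar (P : Params R) (l m : ℕ) : Set (Alg P) :=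
  {x | ∃ ii jj : ℕ → ℕ, ∃ ss : ℕ → ℤ,
    (∀ t, 1 ≤ t → t ≤ m →
      1 ≤ ii t ∧ ii t ≤ jj t ∧ jj t ≤ l + 1 - 2 * t ∧ ss t ∈ Pset P.k) ∧
    (∀ t, 1 ≤ t → t + 1 ≤ m → ii (t + 1) < ii t) ∧
    x = alphaChainBar P l ii jj ss m}

end CBMW

open CBMW

/-- Units `x, a, b` and an element `e` of an algebra satisfying the relations of
`Xᵢ, Yᵢ', Yᵢ₊₁', eᵢ`. -/
structure IsRankTwo {R A : Type*} [CommRing R] [Ring A] [Algebra R A]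
    (δ : R) (lam : Rˣ) (x a b : Aˣ) (e : A) : Prop where
  b_eq : b = x * a * x
  comm : Commute a b
  skein : (x : A) - ↑x⁻¹ = δ • (1 - e)
  x_mul_e : ↑x * e = (lam : R) • e
  e_mul_x : e * ↑x = (lam : R) • e
  b_mul_e : ↑b * e = ↑a⁻¹ * e
  e_mul_b : e * ↑b = e * ↑a⁻¹

namespace IsRankTwo

variable {R A : Type*} [CommRing R] [Ring A] [Algebra R A]
  {δ : R} {lam : Rˣ} {x a b : Aˣ} {e : A}

theorem xinv_mul_e (H : IsRankTwo δ lam x a b e) :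
    (↑x⁻¹ : A) * e = ((lam⁻¹ : Rˣ) : R) • e := by
  rw [Units.inv_mul_eq_iff_eq_mul, mul_smul_comm, H.x_mul_e, smul_smul, Units.inv_mul, one_smul]

theorem e_mul_xinv (H : IsRankTwo δ lam x a b e) :
    e * (↑x⁻¹ : A) = ((lam⁻¹ : Rˣ) : R) • e := by
  rw [Units.mul_inv_eq_iff_eq_mul, smul_mul_assoc, H.e_mul_x, smul_smul, Units.inv_mul, one_smul]

theorem binv_mul_e (H : IsRankTwo δ lam x a b e) : (↑b⁻¹ : A) * e = ↑a * e := by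
  have hc : (a : A) * b = b * a := congrArg Units.val H.comm.eq
  rw [Units.inv_mul_eq_iff_eq_mul, ← mul_assoc, ← hc, mul_assoc, H.b_mul_e, Units.mul_inv_cancel_left]

theorem e_mul_binv (H : IsRankTwo δ lam x a b e) : e * (↑b⁻¹ : A) = e * ↑a := by
  have hc : (a : A) * b = b * a := congrArg Units.val H.comm.eq
  rw [Units.mul_inv_eq_iff_eq_mul, mul_assoc, hc, ← mul_assoc, H.e_mul_b,
    Units.inv_mul_cancel_right]

/-- Inverting the units gives data of the same kind. -/
theorem inv (H : IsRankTwo δ lam x a b e) : IsRankTwo (-δ) lam⁻¹ x⁻¹ a⁻¹ b⁻¹ e where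
  b_eq := by rw [H.b_eq]; group
  comm := H.comm.inv_inv
  skein := by rw [inv_inv, neg_smul, ← H.skein, neg_sub]
  x_mul_e := H.xinv_mul_e
  e_mul_x := H.e_mul_xinv
  b_mul_e := by rw [inv_inv]; exact H.binv_mul_e
  e_mul_b := by rw [inv_inv]; exact H.e_mul_binv

theorem x_eq (H : IsRankTwo δ lam x a b e) : (x : A) = ↑x⁻¹ + δ • 1 - δ • e := by
  rw [add_sub_assoc, ← smul_sub, ← H.skein]; abel

theorem xinv_eq (H : IsRankTwo δ lam x a b e) : (↑x⁻¹ : A) = ↑x - δ • 1 + δ • e := by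
  rw [sub_add, ← smul_sub, ← H.skein]; abel

theorem b_pow_mul_e (H : IsRankTwo δ lam x a b e) (s : ℕ) :
    (↑(b ^ s) : A) * e = ↑(a⁻¹ ^ s) * e := by
  induction s with
  | zero => simp
  | succ s ih =>
    have hc : Commute ((b ^ s : Aˣ) : A) ((a⁻¹ : Aˣ) : A) :=
      Commute.units_val (H.comm.symm.inv_right.pow_left s)
    rw [pow_succ, Units.val_mul, mul_assoc, H.b_mul_e, ← mul_assoc, hc.eq, mul_assoc, ih,
      ← mul_assoc, pow_succ', Units.val_mul]

theorem e_mul_b_pow (H : IsRankTwo δ lam x a b e) (s : ℕ) :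
    e * (↑(b ^ s) : A) = e * ↑(a⁻¹ ^ s) := by
  induction s with
  | zero => simp
  | succ s ih =>
    have hc : Commute ((b : Aˣ) : A) ((a⁻¹ ^ s : Aˣ) : A) :=
      Commute.units_val (H.comm.symm.inv_right.pow_right s)
    rw [pow_succ, Units.val_mul, ← mul_assoc, ih, mul_assoc, ← hc.eq, ← mul_assoc, H.e_mul_b,
      mul_assoc, pow_succ', Units.val_mul]

theorem x_mul_a (H : IsRankTwo δ lam x a b e) :
    (x : A) * a = b * x - δ • (b : A) + δ • (b * e) := by
  have h1 : (x : A) * a = b * ↑x⁻¹ := by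
    rw [H.b_eq]; push_cast; rw [Units.mul_inv_cancel_right]
  rw [h1, H.xinv_eq, mul_add, mul_sub, mul_smul_comm, mul_one, mul_smul_comm]

theorem xinv_mul_b (H : IsRankTwo δ lam x a b e) :
    (↑x⁻¹ : A) * b = a * ↑x⁻¹ + δ • (a : A) - δ • (a * e) := by
  have h1 : (↑x⁻¹ : A) * b = a * x := by
    rw [H.b_eq]; push_cast; rw [mul_assoc, Units.inv_mul_cancel_left]
  rw [h1, H.x_eq, mul_sub, mul_add, mul_smul_comm, mul_one, mul_smul_comm]

variable (N : Submodule R A)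

theorem mul_x_mem (H : IsRankTwo δ lam x a b e) {u v : A} (h0 : u * ↑x⁻¹ * v ∈ N)
    (h1 : u * v ∈ N) (h2 : u * e * v ∈ N) : u * x * v ∈ N := by
  rw [H.x_eq, mul_sub, mul_add, sub_mul, add_mul, mul_smul_comm, mul_smul_comm, mul_one,
    smul_mul_assoc, smul_mul_assoc]
  exact sub_mem (add_mem h0 (N.smul_mem _ h1)) (N.smul_mem _ h2)

theorem mul_xinv_mem (H : IsRankTwo δ lam x a b e) {u v : A} (h0 : u * x * v ∈ N)
    (h1 : u * v ∈ N) (h2 : u * e * v ∈ N) : u * ↑x⁻¹ * v ∈ N := by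
  rw [H.xinv_eq, mul_add, mul_sub, add_mul, sub_mul, mul_smul_comm, mul_smul_comm, mul_one,
    smul_mul_assoc, smul_mul_assoc]
  exact add_mem (sub_mem h0 (N.smul_mem _ h1)) (N.smul_mem _ h2)

/-- Moving `x` to the right past a power of `a`. -/
theorem x_mul_a_pow_mem (H : IsRankTwo δ lam x a b e) {u v : A} {p : ℕ}
    (h0 : u * ↑(b ^ p) * ↑x * v ∈ N)
    (h1 : ∀ s q : ℕ, 1 ≤ s → s + q = p → u * ↑(b ^ s) * ↑(a ^ q) * v ∈ N)
    (h2 : ∀ s q : ℕ, 1 ≤ s → s + q = p → u * ↑(b ^ s) * e * ↑(a ^ q) * v ∈ N) :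
    u * ↑x * ↑(a ^ p) * v ∈ N := by
  induction p generalizing u with
  | zero => simpa using h0
  | succ p ih =>
    have key : u * ↑x * ↑(a ^ (p + 1)) * v = (u * b) * ↑x * ↑(a ^ p) * v
        - δ • (u * ↑(b ^ 1) * ↑(a ^ p) * v) + δ • (u * ↑(b ^ 1) * e * ↑(a ^ p) * v) := by
      rw [pow_succ' a, Units.val_mul, ← mul_assoc, mul_assoc u, H.x_mul_a, pow_one]
      simp only [mul_add, mul_sub, add_mul, sub_mul, mul_smul_comm, smul_mul_assoc, mul_assoc]
    rw [key]
    refine add_mem (sub_mem (ih ?_ ?_ ?_) (N.smul_mem _ (h1 1 p le_rfl (add_comm _ _))))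
      (N.smul_mem _ (h2 1 p le_rfl (add_comm _ _)))
    · rw [mul_assoc u, ← Units.val_mul, ← pow_succ']; exact h0
    · intro s q hs hsq
      rw [mul_assoc u, ← Units.val_mul, ← pow_succ']
      exact h1 (s + 1) q (by omega) (by omega)
    · intro s q hs hsq
      rw [mul_assoc u, ← Units.val_mul, ← pow_succ']
      exact h2 (s + 1) q (by omega) (by omega)

/-- Moving `x⁻¹` to the right past a power of `b`. -/
theorem xinv_mul_b_pow_mem (H : IsRankTwo δ lam x a b e) {u v : A} {p : ℕ}
    (h0 : u * ↑(a ^ p) * ↑x⁻¹ * v ∈ N)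
    (h1 : ∀ s q : ℕ, 1 ≤ s → s + q = p → u * ↑(a ^ s) * ↑(b ^ q) * v ∈ N)
    (h2 : ∀ s q : ℕ, 1 ≤ s → s + q = p → u * ↑(a ^ s) * e * ↑(b ^ q) * v ∈ N) :
    u * ↑x⁻¹ * ↑(b ^ p) * v ∈ N := by
  induction p generalizing u with
  | zero => simpa using h0
  | succ p ih =>
    have key : u * ↑x⁻¹ * ↑(b ^ (p + 1)) * v = (u * a) * ↑x⁻¹ * ↑(b ^ p) * v
        + δ • (u * ↑(a ^ 1) * ↑(b ^ p) * v) - δ • (u * ↑(a ^ 1) * e * ↑(b ^ p) * v) := by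
      rw [pow_succ' b, Units.val_mul, ← mul_assoc, mul_assoc u, H.xinv_mul_b, pow_one]
      simp only [mul_add, mul_sub, add_mul, sub_mul, mul_smul_comm, smul_mul_assoc, mul_assoc]
    rw [key]
    refine sub_mem (add_mem (ih ?_ ?_ ?_) (N.smul_mem _ (h1 1 p le_rfl (add_comm _ _))))
      (N.smul_mem _ (h2 1 p le_rfl (add_comm _ _)))
    · rw [mul_assoc u, ← Units.val_mul, ← pow_succ']; exact h0
    · intro s q hs hsq
      rw [mul_assoc u, ← Units.val_mul, ← pow_succ']
      exact h1 (s + 1) q (by omega) (by omega)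
    · intro s q hs hsq
      rw [mul_assoc u, ← Units.val_mul, ← pow_succ']
      exact h2 (s + 1) q (by omega) (by omega)
end IsRankTwo

/-- The ordered product `f i * f (i + 1) * ⋯ * f (j - 1)`. -/
def seg {M : Type*} [Monoid M] (f : ℕ → M) (i j : ℕ) : M :=
  ((List.range' i (j - i)).map f).prod

section Seg

variable {M : Type*} [Monoid M] (f : ℕ → M)

theorem seg_of_le {i j : ℕ} (h : j ≤ i) : seg f i j = 1 := by
  simp [seg, Nat.sub_eq_zero_of_le h]

@[simp] theorem seg_self (i : ℕ) : seg f i i = 1 := seg_of_le f le_rfl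

theorem seg_cons {i j : ℕ} (h : i < j) : seg f i j = f i * seg f (i + 1) j := by
  obtain ⟨d, rfl⟩ := Nat.exists_eq_add_of_lt h
  have h1 : i + d + 1 - i = d + 1 := by omega
  have h2 : i + d + 1 - (i + 1) = d := by omega
  simp [seg, h1, h2, List.range'_succ]

theorem seg_snoc {i j : ℕ} (h : i ≤ j) : seg f i (j + 1) = seg f i j * f j := by
  have h1 : j + 1 - i = (j - i) + 1 := by omega
  have h2 : i + (j - i) = j := by omega
  simp [seg, h1, List.range'_concat, h2]

@[simp] theorem seg_one (i : ℕ) : seg f i (i + 1) = f i := by simp [seg_snoc]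

theorem seg_mul_seg {i j m : ℕ} (hij : i ≤ j) (hjm : j ≤ m) :
    seg f i j * seg f j m = seg f i m := by
  induction m, hjm using Nat.le_induction with
  | base => simp
  | succ m hm ih => rw [seg_snoc f hm, seg_snoc f (hij.trans hm), ← mul_assoc, ih]

theorem seg_mem {S : Submonoid M} {i j : ℕ} (h : ∀ t, i ≤ t → t < j → f t ∈ S) :
    seg f i j ∈ S := by
  refine S.list_prod_mem fun x hx => ?_
  obtain ⟨t, ht, rfl⟩ := List.mem_map.1 hx
  rw [List.mem_range'_1] at ht
  exact h t ht.1 (by omega)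

theorem commute_seg {a : M} {i j : ℕ} (h : ∀ t, i ≤ t → t < j → Commute a (f t)) :
    Commute a (seg f i j) := by
  have := seg_mem f (S := Submonoid.centralizer {a}) (i := i) (j := j) fun t h1 h2 => by
    simpa [Submonoid.mem_centralizer_iff] using (h t h1 h2).eq
  exact Submonoid.mem_centralizer_iff.1 this a rfl

theorem semiconjBy_seg {a : M} {i j d : ℕ}
    (h : ∀ t, i ≤ t → t < j → SemiconjBy a (f t) (f (t + d))) :
    SemiconjBy a (seg f i j) (seg f (i + d) (j + d)) := by
  rcases le_total j i with hji | hij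
  · rw [seg_of_le f hji, seg_of_le f (by omega)]; exact SemiconjBy.one_right a
  induction j, hij using Nat.le_induction with
  | base => simp
  | succ j hj ih =>
    rw [seg_snoc f hj, add_right_comm, seg_snoc f (by omega)]
    exact (ih fun t h1 h2 => h t h1 (by omega)).mul_right (h j hj (by omega))

end Seg

namespace CBMW

variable {R : Type} [CommRing R] (P : Params R)

theorem pr_rel {P : Params R} {a b : F R} (h : Rel P a b) : pr P a = pr P b :=
  RingQuot.mkAlgHom_rel R h

theorem invalid_or (n i : ℕ) : (i = 0 ∨ n - 1 < i) ∨ (1 ≤ i ∧ i ≤ n - 1) := by omega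

theorem Xg_mul_Xgi (i : ℕ) : Xg P i * Xgi P i = 1 := by
  rcases invalid_or P.n i with h | h
  · simpa [Xg, Xgi] using congrArg₂ (· * ·) (pr_rel (Rel.X_invalid (P := P) h))
      (pr_rel (Rel.Xi_invalid (P := P) h))
  · simpa [Xg, Xgi] using pr_rel (Rel.X_inv_right (P := P) h.1 h.2)

theorem Xgi_mul_Xg (i : ℕ) : Xgi P i * Xg P i = 1 := by
  rcases invalid_or P.n i with h | h
  · simpa [Xg, Xgi] using congrArg₂ (· * ·) (pr_rel (Rel.Xi_invalid (P := P) h))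
      (pr_rel (Rel.X_invalid (P := P) h))
  · simpa [Xg, Xgi] using pr_rel (Rel.X_inv_left (P := P) h.1 h.2)

/-- `Xᵢ` as a unit. -/
def Xu (i : ℕ) : (Alg P)ˣ := ⟨Xg P i, Xgi P i, Xg_mul_Xgi P i, Xgi_mul_Xg P i⟩

/-- `Y` as a unit. -/
def Yu : (Alg P)ˣ :=
  ⟨Yg P, Ygi P, by simpa [Yg, Ygi] using pr_rel (Rel.Y_inv_right (P := P)),
    by simpa [Yg, Ygi] using pr_rel (Rel.Y_inv_left (P := P))⟩

/-- `Yᵢ'` as a unit. -/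
def Ju : ℕ → (Alg P)ˣ
  | 0 => Yu P
  | i + 1 => Xu P i * Ju i * Xu P i

theorem Ju_succ (i : ℕ) : Ju P (i + 1) = Xu P i * Ju P i * Xu P i := rfl

@[simp] theorem val_Xu (i : ℕ) : (Xu P i : Alg P) = Xg P i := rfl
@[simp] theorem val_inv_Xu (i : ℕ) : (↑(Xu P i)⁻¹ : Alg P) = Xgi P i := rfl
@[simp] theorem val_Yu : (Yu P : Alg P) = Yg P := rfl
@[simp] theorem val_inv_Yu : (↑(Yu P)⁻¹ : Alg P) = Ygi P := rfl

theorem Xg_invalid {i : ℕ} (h : i = 0 ∨ P.n - 1 < i) : Xg P i = 1 := by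
  simpa [Xg] using pr_rel (Rel.X_invalid (P := P) h)

theorem Eg_invalid {i : ℕ} (h : i = 0 ∨ P.n - 1 < i) : Eg P i = 0 := by
  simpa [Eg] using pr_rel (Rel.E_invalid (P := P) h)

theorem Xu_zero : Xu P 0 = 1 := Units.ext (Xg_invalid P (Or.inl rfl))

theorem Ju_one : Ju P 1 = Yu P := by rw [Ju_succ, Xu_zero]; simp [Ju]

theorem downX_eq (i : ℕ) : downX P i * Yg P * upX P i = Ju P (i + 1) := by
  induction i with
  | zero => simp [downX, upX, Ju_one]
  | succ i ih => rw [Ju_succ]; simp only [Units.val_mul, ← ih, downX, upX, mul_assoc, val_Xu]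

theorem downXi_eq (i : ℕ) : downXi P i * Ygi P * upXi P i = ↑(Ju P (i + 1))⁻¹ := by
  induction i with
  | zero => simp [downXi, upXi, Ju_one]
  | succ i ih =>
    rw [Ju_succ]
    simp only [mul_inv_rev, Units.val_mul, ← ih, downXi, upXi, mul_assoc, val_inv_Xu]

theorem Ypow_eq {i : ℕ} (hi : 1 ≤ i) (p : ℤ) : Ypow P i p = ↑(Ju P i ^ p) := by
  obtain ⟨i, rfl⟩ := Nat.exists_eq_add_of_le' hi
  rw [Ypow, Yp, YpInv, Nat.add_sub_cancel, downX_eq, downXi_eq]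
  split_ifs with h
  · obtain ⟨m, rfl⟩ := Int.eq_ofNat_of_zero_le h
    simp
  · obtain ⟨m, hm⟩ := Int.eq_ofNat_of_zero_le (show 0 ≤ -p by omega)
    obtain rfl : p = -(m : ℤ) := by omega
    simp [zpow_neg]

theorem commute_Xg_Xg {i j : ℕ} (h : i + 2 ≤ j ∨ j + 2 ≤ i) : Commute (Xg P i) (Xg P j) := by
  rcases invalid_or P.n i with hi | hi
  · rw [Xg_invalid P hi]; exact Commute.one_left _
  rcases invalid_or P.n j with hj | hj
  · rw [Xg_invalid P hj]; exact Commute.one_right _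
  simpa [Xg, Commute, SemiconjBy] using pr_rel (Rel.XX_far (P := P) hi.1 hi.2 hj.1 hj.2 h)

theorem commute_Xg_Eg {i j : ℕ} (h : i + 2 ≤ j ∨ j + 2 ≤ i) : Commute (Xg P i) (Eg P j) := by
  rcases invalid_or P.n i with hi | hi
  · rw [Xg_invalid P hi]; exact Commute.one_left _
  rcases invalid_or P.n j with hj | hj
  · rw [Eg_invalid P hj]; exact Commute.zero_right _
  simpa [Xg, Eg, Commute, SemiconjBy] using pr_rel (Rel.XE_far (P := P) hi.1 hi.2 hj.1 hj.2 h)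

theorem commute_Eg_Eg {i j : ℕ} (h : i + 2 ≤ j ∨ j + 2 ≤ i) : Commute (Eg P i) (Eg P j) := by
  rcases invalid_or P.n i with hi | hi
  · rw [Eg_invalid P hi]; exact Commute.zero_left _
  rcases invalid_or P.n j with hj | hj
  · rw [Eg_invalid P hj]; exact Commute.zero_right _
  simpa [Eg, Commute, SemiconjBy] using pr_rel (Rel.EE_far (P := P) hi.1 hi.2 hj.1 hj.2 h)

theorem commute_Yg_Xg {i : ℕ} (h : i ≠ 1) : Commute (Yg P) (Xg P i) := by
  rcases invalid_or P.n i with hi | hi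
  · rw [Xg_invalid P hi]; exact Commute.one_right _
  simpa [Xg, Yg, Commute, SemiconjBy] using pr_rel (Rel.YX_comm (P := P) (by omega) hi.2)

theorem commute_Yg_Eg {i : ℕ} (h : i ≠ 1) : Commute (Yg P) (Eg P i) := by
  rcases invalid_or P.n i with hi | hi
  · rw [Eg_invalid P hi]; exact Commute.zero_right _
  simpa [Eg, Yg, Commute, SemiconjBy] using pr_rel (Rel.YE_comm (P := P) (by omega) hi.2)

theorem braid {i : ℕ} (h1 : 1 ≤ i) (h2 : i + 1 ≤ P.n - 1) :
    Xg P i * Xg P (i + 1) * Xg P i = Xg P (i + 1) * Xg P i * Xg P (i + 1) := by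
  simpa [Xg] using pr_rel (Rel.braid (P := P) h1 h2)

theorem skein {i : ℕ} (h1 : 1 ≤ i) (h2 : i ≤ P.n - 1) :
    Xg P i - Xgi P i = P.delta • (1 - Eg P i) := by
  simpa [Xg, Xgi, Eg] using pr_rel (Rel.skein (P := P) h1 h2)

theorem Xg_mul_Eg {i : ℕ} (h1 : 1 ≤ i) (h2 : i ≤ P.n - 1) :
    Xg P i * Eg P i = (P.lam : R) • Eg P i := by
  simpa [Xg, Eg] using pr_rel (Rel.untwist_right (P := P) h1 h2)

theorem Eg_mul_Xg {i : ℕ} (h1 : 1 ≤ i) (h2 : i ≤ P.n - 1) :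
    Eg P i * Xg P i = (P.lam : R) • Eg P i := by
  simpa [Xg, Eg] using pr_rel (Rel.untwist_left (P := P) h1 h2)

theorem XXE_up {i : ℕ} (h1 : 1 ≤ i) (h2 : i + 1 ≤ P.n - 1) :
    Xg P i * Xg P (i + 1) * Eg P i = Eg P (i + 1) * Eg P i := by
  simpa [Xg, Eg] using pr_rel (Rel.XXE (P := P) (j := i + 1) h1 (by omega) (by omega) h2
    (Or.inl rfl))

theorem XXE_down {i : ℕ} (h1 : 1 ≤ i) (h2 : i + 1 ≤ P.n - 1) :
    Xg P (i + 1) * Xg P i * Eg P (i + 1) = Eg P i * Eg P (i + 1) := by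
  simpa [Xg, Eg] using pr_rel (Rel.XXE (P := P) (i := i + 1) (j := i) (by omega) h2 h1 (by omega)
    (Or.inr rfl))

theorem EXX_up {i : ℕ} (h1 : 1 ≤ i) (h2 : i + 1 ≤ P.n - 1) :
    Eg P (i + 1) * Xg P i * Xg P (i + 1) = Eg P (i + 1) * Eg P i := by
  simpa [Xg, Eg] using (pr_rel (Rel.EXX (P := P) (j := i + 1) h1 (by omega) (by omega) h2
    (Or.inl rfl))).symm

theorem EXX_down {i : ℕ} (h1 : 1 ≤ i) (h2 : i + 1 ≤ P.n - 1) :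
    Eg P i * Xg P (i + 1) * Xg P i = Eg P i * Eg P (i + 1) := by
  simpa [Xg, Eg] using (pr_rel (Rel.EXX (P := P) (i := i + 1) (j := i) (by omega) h2 h1
    (by omega) (Or.inr rfl))).symm

theorem EEE_up {i : ℕ} (h1 : 1 ≤ i) (h2 : i + 1 ≤ P.n - 1) :
    Eg P i * Eg P (i + 1) * Eg P i = Eg P i := by
  simpa [Eg] using pr_rel (Rel.EEE_up (P := P) h1 h2)

theorem EEE_down {i : ℕ} (h1 : 1 ≤ i) (h2 : i + 1 ≤ P.n - 1) :
    Eg P (i + 1) * Eg P i * Eg P (i + 1) = Eg P (i + 1) := by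
  simpa [Eg] using pr_rel (Rel.EEE_down (P := P) h1 h2)

theorem cyclo : Yg P ^ P.k = ∑ i ∈ Finset.range P.k, P.qc i • Yg P ^ i := by
  simpa [Yg] using pr_rel (Rel.cyclo (P := P))

theorem braidB (h : 2 ≤ P.n) :
    Xg P 1 * Yg P * Xg P 1 * Yg P = Yg P * Xg P 1 * Yg P * Xg P 1 := by
  simpa [Yg, Xg] using pr_rel (Rel.braidB (P := P) h)

theorem YXYE (h : 2 ≤ P.n) : Yg P * Xg P 1 * Yg P * Eg P 1 = P.laminv • Eg P 1 := by
  simpa [Yg, Xg, Eg] using pr_rel (Rel.YXYE (P := P) h)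

theorem EYXY (h : 2 ≤ P.n) : Eg P 1 * (Yg P * Xg P 1 * Yg P) = P.laminv • Eg P 1 := by
  simpa [Yg, Xg, Eg] using pr_rel (Rel.EYXY (P := P) h)

theorem EYE {m : ℕ} (h : 2 ≤ P.n) (hm : m ≤ P.k - 1) :
    Eg P 1 * Yg P ^ m * Eg P 1 = P.A m • Eg P 1 := by
  simpa [Yg, Eg] using pr_rel (Rel.EYE (P := P) h hm)

end CBMW

section Words

variable {M : Type*} [Monoid M] {x y e f J : M}

theorem commute_conj_conj_of_braid (hb : x * y * x = y * x * y) (hJ : Commute y J) :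
    Commute (y * (x * J * x) * y) x := by
  have h := hJ.eq
  calc y * (x * J * x) * y * x = y * x * J * (x * y * x) := by simp only [mul_assoc]
    _ = y * x * (J * y) * x * y := by rw [hb]; simp only [mul_assoc]
    _ = (y * x * y) * J * x * y := by rw [← h]; simp only [mul_assoc]
    _ = x * (y * (x * J * x) * y) := by rw [← hb]; simp only [mul_assoc]

theorem commute_conj_conj_of_tangle (h1 : y * x * f = e * f) (h2 : e * y * x = e * f)
    (h3 : x * y * e = f * e) (h4 : f * x * y = f * e) (hJ : Commute f J) :
    Commute (y * (x * J * x) * y) e := by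
  have h := hJ.eq
  change y * (x * J * x) * y * e = e * (y * (x * J * x) * y)
  have l1 : y * (x * J * x) * y * e = y * x * J * (x * y * e) := by simp only [mul_assoc]
  have l2 : e * (y * (x * J * x) * y) = (e * y * x) * J * (x * y) := by simp only [mul_assoc]
  rw [l1, l2, h3, h2]
  have l3 : y * x * J * (f * e) = (y * x * f) * J * e := by
    simp only [mul_assoc]; rw [← mul_assoc J, ← h, mul_assoc]
  have l4 : e * f * J * (x * y) = e * J * (f * x * y) := by
    simp only [mul_assoc]; rw [← mul_assoc f, h, mul_assoc]
  rw [l3, l4, h1, h4]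
  simp only [mul_assoc]; rw [← mul_assoc f, h, mul_assoc]

theorem conj_mul_conj_conj_mul (hb : x * y * x = y * x * y) (hJ : Commute y J)
    (h1 : y * x * f = e * f) (h2 : x * y * e = f * e) (h3 : f * e * f = f)
    (hJe : J * (x * J * x) * e = e) :
    (x * J * x) * (y * (x * J * x) * y) * f = f := by
  have h := hJ.eq
  have l : (x * J * x) * (y * (x * J * x) * y) = x * y * (J * (x * J * x)) * (y * x) :=
    calc _ = x * J * (x * y * x) * J * x * y := by simp only [mul_assoc]
      _ = x * (J * y) * x * (y * J) * x * y := by rw [hb]; simp only [mul_assoc]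
      _ = x * y * J * x * J * (y * x * y) := by rw [← h]; nth_rewrite 2 [h]; simp only [mul_assoc]
      _ = _ := by rw [← hb]; simp only [mul_assoc]
  calc _ = x * y * (J * (x * J * x)) * (y * x * f) := by rw [l]; simp only [mul_assoc]
    _ = x * y * (J * (x * J * x) * e) * f := by rw [h1]; simp only [mul_assoc]
    _ = f := by rw [hJe, h2, h3]

theorem mul_conj_conj_mul_conj (hb : x * y * x = y * x * y) (hJ : Commute y J)
    (h1 : f * x * y = f * e) (h2 : e * y * x = e * f) (h3 : f * e * f = f)
    (hJe : e * ((x * J * x) * J) = e) :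
    f * ((y * (x * J * x) * y) * (x * J * x)) = f := by
  have h := hJ.eq
  have l : (y * (x * J * x) * y) * (x * J * x) = x * y * ((x * J * x) * J) * (y * x) :=
    calc _ = y * x * J * (x * y * x) * J * x := by simp only [mul_assoc]
      _ = y * x * (J * y) * x * (y * J) * x := by rw [hb]; simp only [mul_assoc]
      _ = (y * x * y) * J * x * J * y * x := by rw [← h]; nth_rewrite 2 [h]; simp only [mul_assoc]
      _ = _ := by rw [← hb]; simp only [mul_assoc]
  calc _ = (f * x * y) * ((x * J * x) * J) * (y * x) := by rw [l]; simp only [mul_assoc]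
    _ = f * (e * ((x * J * x) * J)) * (y * x) := by rw [h1]; simp only [mul_assoc]
    _ = f := by rw [hJe]; rw [mul_assoc, ← mul_assoc e, h2, ← mul_assoc, h3]

end Words

namespace CBMW

variable {R : Type} [CommRing R] (P : Params R)

theorem commute_Ju_of_lt {a : Alg P} {i : ℕ} (hY : Commute a (Yg P))
    (hX : ∀ t, 1 ≤ t → t < i → Commute a (Xg P t)) : Commute a (Ju P i) := by
  induction i with
  | zero => simpa [Ju] using hY
  | succ i ih =>
    have hXi : Commute a (Xg P i) := by
      rcases Nat.eq_zero_or_pos i with rfl | hi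
      · rw [Xg_invalid P (Or.inl rfl)]; exact Commute.one_right _
      · exact hX i hi (by omega)
    rw [Ju_succ, Units.val_mul, Units.val_mul]
    exact (hXi.mul_right (ih fun t h1 h2 => hX t h1 (by omega))).mul_right hXi

theorem commute_Xg_Ju_of_lt {i t : ℕ} (hi : 1 ≤ i) (h : i < t) : Commute (Xg P t) (Ju P i) :=
  commute_Ju_of_lt P (commute_Yg_Xg P (by omega)).symm
    fun s _ hs => commute_Xg_Xg P (by omega)

theorem commute_Eg_Ju_of_lt {i t : ℕ} (hi : 1 ≤ i) (h : i < t) : Commute (Eg P t) (Ju P i) :=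
  commute_Ju_of_lt P (commute_Yg_Eg P (by omega)).symm
    fun s _ hs => (commute_Xg_Eg P (by omega)).symm

theorem commute_Yg_Ju (i : ℕ) : Commute (Yg P) (Ju P i) := by
  rcases i with - | - | i
  · exact Commute.refl _
  · rw [Ju_one]; exact Commute.refl _
  induction i with
  | zero =>
    rw [Ju_succ, Ju_one]
    rcases le_or_gt 2 P.n with h | h
    · have := braidB P h
      simpa [Commute, SemiconjBy, mul_assoc] using this.symm
    · simp [Xg_invalid P (i := 1) (by omega)]
  | succ i ih =>
    rw [Ju_succ, Units.val_mul, Units.val_mul]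
    exact ((commute_Yg_Xg P (by omega)).mul_right ih).mul_right (commute_Yg_Xg P (by omega))

theorem commute_Xg_Ju_of_gt {i t : ℕ} (ht : 1 ≤ t) (hn : t + 2 ≤ P.n) (h : t + 2 ≤ i) :
    Commute (Xg P t) (Ju P i) := by
  induction i, h using Nat.le_induction with
  | base =>
    rw [Ju_succ, Ju_succ]
    exact (commute_conj_conj_of_braid (braid P ht (by omega))
      (commute_Xg_Ju_of_lt P ht (by omega))).symm
  | succ i hi ih =>
    rw [Ju_succ, Units.val_mul, Units.val_mul]
    exact ((commute_Xg_Xg P (by omega)).mul_right ih).mul_right (commute_Xg_Xg P (by omega))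

theorem commute_Eg_Ju_of_gt {i t : ℕ} (ht : 1 ≤ t) (hn : t + 2 ≤ P.n) (h : t + 2 ≤ i) :
    Commute (Eg P t) (Ju P i) := by
  induction i, h using Nat.le_induction with
  | base =>
    have h2 : t + 1 ≤ P.n - 1 := by omega
    rw [Ju_succ, Ju_succ]
    exact (commute_conj_conj_of_tangle (XXE_down P ht h2) (EXX_down P ht h2) (XXE_up P ht h2)
      (EXX_up P ht h2) (commute_Eg_Ju_of_lt P ht (by omega))).symm
  | succ i hi ih =>
    rw [Ju_succ, Units.val_mul, Units.val_mul]
    exact ((commute_Xg_Eg P (by omega)).symm.mul_right ih).mul_right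
      (commute_Xg_Eg P (by omega)).symm

theorem commute_Ju_Ju {i j : ℕ} (hij : i < j) (hn : j ≤ P.n) : Commute (Ju P i) (Ju P j) :=
  Commute.units_of_val (commute_Ju_of_lt P (commute_Yg_Ju P j).symm fun t h1 h2 =>
    (commute_Xg_Ju_of_gt P h1 (by omega) (by omega)).symm).symm

theorem Ju_mul_Ju_mul_Eg {i : ℕ} (h1 : 1 ≤ i) (h2 : i ≤ P.n - 1) :
    (Ju P i : Alg P) * Ju P (i + 1) * Eg P i = Eg P i := by
  induction i, h1 using Nat.le_induction with
  | base =>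
    have : (Ju P 1 : Alg P) * Ju P (1 + 1) * Eg P 1
        = Yg P * Xg P 1 * Yg P * (Xg P 1 * Eg P 1) := by
      simp [Ju_succ P 1, Ju_one, mul_assoc]
    rw [this, Xg_mul_Eg P le_rfl h2, mul_smul_comm, YXYE P (by omega), smul_smul, Params.laminv,
      Units.mul_inv, one_smul]
  | succ i hi ih =>
    have ih := ih (by omega)
    rw [Ju_succ P (i + 1)]
    rw [Ju_succ] at ih ⊢
    exact conj_mul_conj_conj_mul (braid P hi h2) (commute_Xg_Ju_of_lt P hi (by omega))
      (XXE_down P hi h2) (XXE_up P hi h2) (EEE_down P hi h2) ih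

theorem Eg_mul_Ju_mul_Ju {i : ℕ} (h1 : 1 ≤ i) (h2 : i ≤ P.n - 1) :
    Eg P i * ((Ju P (i + 1) : Alg P) * Ju P i) = Eg P i := by
  induction i, h1 using Nat.le_induction with
  | base =>
    have : Eg P 1 * ((Ju P (1 + 1) : Alg P) * Ju P 1)
        = (Eg P 1 * Xg P 1) * (Yg P * Xg P 1 * Yg P) := by
      simp [Ju_succ P 1, Ju_one, mul_assoc]
    rw [this, Eg_mul_Xg P le_rfl h2, smul_mul_assoc, EYXY P (by omega), smul_smul, Params.laminv,
      Units.mul_inv, one_smul]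
  | succ i hi ih =>
    have ih := ih (by omega)
    rw [Ju_succ P (i + 1)]
    rw [Ju_succ] at ih ⊢
    exact mul_conj_conj_mul_conj (braid P hi h2) (commute_Xg_Ju_of_lt P hi (by omega))
      (EXX_up P hi h2) (EXX_down P hi h2) (EEE_down P hi h2) ih

theorem isRankTwo {t : ℕ} (h1 : 1 ≤ t) (h2 : t ≤ P.n - 1) :
    IsRankTwo P.delta P.lam (Xu P t) (Ju P t) (Ju P (t + 1)) (Eg P t) where
  b_eq := Ju_succ P t
  comm := commute_Ju_Ju P (by omega) (by omega)
  skein := skein P h1 h2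
  x_mul_e := Xg_mul_Eg P h1 h2
  e_mul_x := Eg_mul_Xg P h1 h2
  b_mul_e := by
    rw [Units.eq_inv_mul_iff_mul_eq, ← mul_assoc]
    exact Ju_mul_Ju_mul_Eg P h1 h2
  e_mul_b := by
    rw [Units.eq_mul_inv_iff_mul_eq, mul_assoc]
    exact Eg_mul_Ju_mul_Ju P h1 h2

end CBMW

theorem semiconjBy_seg_of_core {M : Type*} [Monoid M] {f : ℕ → M} {a b : M} {i t d j : ℕ}
    (h1 : i ≤ t) (h2 : t + d ≤ j) (hl : ∀ s, i ≤ s → s < t → Commute b (f s))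
    (hr : ∀ s, t + d ≤ s → s < j → Commute a (f s))
    (hc : SemiconjBy (seg f t (t + d)) a b) : SemiconjBy (seg f i j) a b := by
  rw [← seg_mul_seg f h1 (show t ≤ j by omega), ← seg_mul_seg f (show t ≤ t + d by omega) h2]
  exact SemiconjBy.mul_left (commute_seg f hl).symm
    (SemiconjBy.mul_left hc (commute_seg f hr).symm)

theorem seg_two {M : Type*} [Monoid M] (f : ℕ → M) (t : ℕ) : seg f t (t + 2) = f t * f (t + 1) := by
  rw [seg_snoc f (by omega), seg_one]

theorem seg_three {M : Type*} [Monoid M] (f : ℕ → M) (t : ℕ) :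
    seg f t (t + 3) = f t * f (t + 1) * f (t + 2) := by
  rw [seg_snoc f (by omega), seg_two]

namespace CBMW

variable {R : Type} [CommRing R] (P : Params R)

theorem Xgi_mul_Eg_mul_Eg {t : ℕ} (h1 : 1 ≤ t) (h2 : t + 1 ≤ P.n - 1) :
    Xgi P (t + 1) * (Eg P t * Eg P (t + 1)) = Xg P t * Eg P (t + 1) := by
  rw [← val_inv_Xu, Units.inv_mul_eq_iff_eq_mul, ← mul_assoc]
  exact (XXE_down P h1 h2).symm

theorem Xg_mul_Eg_mul_Eg {t : ℕ} (h1 : 1 ≤ t) (h2 : t + 1 ≤ P.n - 1) :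
    Xg P (t + 1) * (Eg P t * Eg P (t + 1)) = Xgi P t * Eg P (t + 1) := by
  rw [← val_inv_Xu, Units.eq_inv_mul_iff_mul_eq, val_Xu, ← mul_assoc, ← mul_assoc, XXE_up P h1 h2,
    EEE_down P h1 h2]

theorem Eg_mul_Xg_succ {t : ℕ} (h1 : 1 ≤ t) (h2 : t + 1 ≤ P.n - 1) :
    Eg P t * Xg P (t + 1) = Eg P t * Eg P (t + 1) * Xgi P t := by
  rw [← val_inv_Xu, Units.eq_mul_inv_iff_mul_eq]
  exact EXX_down P h1 h2

theorem Eg_mul_Eg_mul_Xg {t : ℕ} (h1 : 1 ≤ t) (h2 : t + 1 ≤ P.n - 1) :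
    Eg P t * Eg P (t + 1) * Xg P t = Eg P t * Xgi P (t + 1) := by
  rw [← val_inv_Xu, Units.eq_mul_inv_iff_mul_eq, val_Xu, mul_assoc, mul_assoc,
    ← mul_assoc (Eg P (t + 1)), EXX_up P h1 h2, ← mul_assoc, EEE_up P h1 h2]

theorem commute_Xgi {a : Alg P} {t : ℕ} (h : Commute a (Xg P t)) : Commute a (Xgi P t) :=
  Commute.units_inv_right (u := Xu P t) h

theorem commute_Ju_zpow {a : Alg P} {t : ℕ} (h : Commute a (Ju P t)) (p : ℤ) :
    Commute a ↑(Ju P t ^ p) := h.units_zpow_right p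

/-- `X_i ⋯ X_{j-1} e_j ⋯ e_{m-1}`. -/
def arc (i j m : ℕ) : Alg P := seg (Xg P) i j * seg (Eg P) j m

theorem alpha_eq {i : ℕ} (hi : 1 ≤ i) (j l : ℕ) (p : ℤ) :
    alpha P i j l p = ↑(Ju P i ^ p) * arc P i j (l + 1) := by
  rw [← Ypow_eq P hi, arc, ← mul_assoc]; rfl

theorem semiconjBy_pX_Xg {i j t : ℕ} (hi : 1 ≤ i) (h1 : i ≤ t) (h2 : t + 2 ≤ j)
    (hn : t + 1 ≤ P.n - 1) : SemiconjBy (seg (Xg P) i j) (Xg P t) (Xg P (t + 1)) := by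
  refine semiconjBy_seg_of_core h1 h2 (fun s _ _ => commute_Xg_Xg P (by omega))
    (fun s _ _ => commute_Xg_Xg P (by omega)) ?_
  rw [seg_two, SemiconjBy, braid P (by omega) hn, mul_assoc]

theorem semiconjBy_pX_Eg {i j t : ℕ} (hi : 1 ≤ i) (h1 : i ≤ t) (h2 : t + 2 ≤ j)
    (hn : t + 1 ≤ P.n - 1) : SemiconjBy (seg (Xg P) i j) (Eg P t) (Eg P (t + 1)) := by
  refine semiconjBy_seg_of_core h1 h2 (fun s _ _ => (commute_Xg_Eg P (by omega)).symm)
    (fun s _ _ => (commute_Xg_Eg P (by omega)).symm) ?_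
  rw [seg_two, SemiconjBy, XXE_up P (by omega) hn, ← mul_assoc, EXX_up P (by omega) hn]

theorem semiconjBy_pE_Xg {i j t : ℕ} (hi : 1 ≤ i) (h1 : i ≤ t) (h2 : t + 3 ≤ j)
    (hn : t + 2 ≤ P.n - 1) : SemiconjBy (seg (Eg P) i j) (Xg P t) (Xg P (t + 2)) := by
  refine semiconjBy_seg_of_core h1 h2 (fun s _ _ => commute_Xg_Eg P (by omega))
    (fun s _ _ => commute_Xg_Eg P (by omega)) ?_
  rw [seg_three, SemiconjBy, mul_assoc, ← (commute_Xg_Eg P (Or.inl le_rfl)).eq, ← mul_assoc,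
    Eg_mul_Eg_mul_Xg P (by omega) (by omega), mul_assoc (Eg P t), mul_assoc (Eg P t),
    ← mul_assoc (Xg P (t + 2)), (commute_Xg_Eg P (Or.inr le_rfl)).eq, mul_assoc (Eg P t),
    Xg_mul_Eg_mul_Eg P (by omega) (by omega)]

theorem semiconjBy_pE_Eg {i j t : ℕ} (hi : 1 ≤ i) (h1 : i ≤ t) (h2 : t + 3 ≤ j)
    (hn : t + 2 ≤ P.n - 1) : SemiconjBy (seg (Eg P) i j) (Eg P t) (Eg P (t + 2)) := by
  refine semiconjBy_seg_of_core h1 h2 (fun s _ _ => commute_Eg_Eg P (by omega))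
    (fun s _ _ => commute_Eg_Eg P (by omega)) ?_
  rw [seg_three, SemiconjBy, mul_assoc, ← (commute_Eg_Eg P (Or.inl le_rfl)).eq, ← mul_assoc,
    EEE_up P (by omega) (by omega), mul_assoc (Eg P t), ← mul_assoc (Eg P (t + 2)),
    (commute_Eg_Eg P (Or.inr le_rfl)).eq, mul_assoc (Eg P t), ← mul_assoc (Eg P (t + 2)),
    EEE_down P (by omega) (by omega)]

theorem semiconjBy_pE_Ju {i j t : ℕ} (hi : 1 ≤ i) (h1 : i ≤ t) (h2 : t + 2 ≤ j)
    (hn : t + 1 ≤ P.n - 1) : SemiconjBy (seg (Eg P) i j) (Ju P t) (Ju P (t + 2)) := by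
  refine semiconjBy_seg_of_core h1 h2
    (fun s _ _ => (commute_Eg_Ju_of_gt P (by omega) (by omega) (by omega)).symm)
    (fun s _ _ => (commute_Eg_Ju_of_lt P (by omega) (by omega)).symm) ?_
  have H := isRankTwo P (t := t) (by omega) (by omega)
  have H' := isRankTwo P (t := t + 1) (by omega) hn
  rw [seg_two, SemiconjBy, mul_assoc, (commute_Eg_Ju_of_lt P (by omega) (by omega)).eq,
    ← mul_assoc, ← H.e_mul_binv, mul_assoc, ← H'.b_mul_e, ← mul_assoc, ← mul_assoc,
    (commute_Eg_Ju_of_gt P (by omega) (by omega) (by omega)).eq]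

theorem pE_mul_pE {j h m : ℕ} (hj : 1 ≤ j) (hjh : j ≤ h) (hhm : h + 1 ≤ m) (hn : m + 1 ≤ P.n - 1) :
    seg (Eg P) j (m + 2) * seg (Eg P) h m = seg (Eg P) (h + 2) (m + 2) * seg (Eg P) j m := by
  obtain ⟨m, rfl⟩ := Nat.exists_eq_add_of_le' (show 1 ≤ m by omega)
  have hm : h ≤ m := by omega
  induction hm using Nat.decreasingInduction with
  | self =>
    rw [seg_one, seg_one, ← seg_mul_seg _ hjh (by omega), seg_three, seg_snoc _ hjh,
      mul_assoc, mul_assoc _ _ (Eg P m), ← (commute_Eg_Eg P (Or.inl le_rfl)).eq,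
      ← mul_assoc (Eg P m * _), EEE_up P (by omega) (by omega),
      (commute_Eg_Eg P (Or.inl le_rfl)).eq, ← mul_assoc, ← mul_assoc,
      (commute_seg (Eg P) fun t _ _ => commute_Eg_Eg P (by omega)).eq]
  | of_succ h hh ih =>
    rw [seg_cons _ (show h < m + 1 by omega), seg_cons _ (show h + 2 < m + 1 + 2 by omega),
      ← mul_assoc, (semiconjBy_pE_Eg P hj hjh (by omega) (by omega)).eq, mul_assoc, mul_assoc,
      ih (by omega) (by omega)]

theorem commute_pX_pX {i j g h : ℕ} (hd : j + 1 ≤ g ∨ h + 1 ≤ i) :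
    Commute (seg (Xg P) i j) (seg (Xg P) g h) :=
  commute_seg _ fun s _ _ => (commute_seg _ fun t _ _ => commute_Xg_Xg P (by omega)).symm

theorem commute_pX_pE {i j g h : ℕ} (hd : j + 1 ≤ g ∨ h + 1 ≤ i) :
    Commute (seg (Xg P) i j) (seg (Eg P) g h) :=
  commute_seg _ fun s _ _ => (commute_seg _ fun t _ _ => (commute_Xg_Eg P (by omega)).symm).symm

theorem commute_pE_pE {i j g h : ℕ} (hd : j + 1 ≤ g ∨ h + 1 ≤ i) :
    Commute (seg (Eg P) i j) (seg (Eg P) g h) :=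
  commute_seg _ fun s _ _ => (commute_seg _ fun t _ _ => (commute_Eg_Eg P (by omega))).symm

theorem arc_mul_Ju_mul_arc {i j g h m : ℕ} (hi : 1 ≤ i) (hij : i ≤ j) (hjg : j ≤ g) (hgh : g ≤ h)
    (hhm : h + 1 ≤ m) (hn : m + 1 ≤ P.n - 1) (r : ℤ) :
    arc P i j (m + 2) * (↑(Ju P g ^ r) * arc P g h m)
      = ↑(Ju P (g + 2) ^ r) * arc P (g + 2) (h + 2) (m + 2) * arc P i j m := by
  have e1 : seg (Eg P) j (m + 2) * ↑(Ju P g ^ r) = ↑(Ju P (g + 2) ^ r) * seg (Eg P) j (m + 2) :=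
    ((semiconjBy_pE_Ju P (by omega) hjg (by omega) (by omega)).units_zpow_right r).eq
  have e2 : seg (Eg P) j (m + 2) * seg (Xg P) g h
      = seg (Xg P) (g + 2) (h + 2) * seg (Eg P) j (m + 2) :=
    (semiconjBy_seg _ fun t _ _ =>
      semiconjBy_pE_Xg P (by omega) (by omega) (by omega) (by omega)).eq
  have e3 := pE_mul_pE P (show 1 ≤ j by omega) (hjg.trans hgh) hhm hn
  have c1 : seg (Xg P) i j * ↑(Ju P (g + 2) ^ r) = ↑(Ju P (g + 2) ^ r) * seg (Xg P) i j :=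
    commute_Ju_zpow P (commute_seg _ fun t _ _ =>
      (commute_Xg_Ju_of_gt P (by omega) (by omega) (by omega)).symm).symm r
  have c2 : seg (Xg P) i j * seg (Xg P) (g + 2) (h + 2)
      = seg (Xg P) (g + 2) (h + 2) * seg (Xg P) i j :=
    commute_pX_pX P (by omega)
  have c3 : seg (Xg P) i j * seg (Eg P) (h + 2) (m + 2)
      = seg (Eg P) (h + 2) (m + 2) * seg (Xg P) i j :=
    commute_pX_pE P (by omega)
  simp only [arc]
  calc _ = seg (Xg P) i j * (seg (Eg P) j (m + 2) * ↑(Ju P g ^ r)) * seg (Xg P) g h * seg (Eg P) h m := by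
        simp only [mul_assoc]
    _ = (seg (Xg P) i j * ↑(Ju P (g + 2) ^ r)) * (seg (Eg P) j (m + 2) * seg (Xg P) g h) * seg (Eg P) h m := by
        rw [e1]; simp only [mul_assoc]
    _ = ↑(Ju P (g + 2) ^ r) * (seg (Xg P) i j * seg (Xg P) (g + 2) (h + 2)) * (seg (Eg P) j (m + 2) * seg (Eg P) h m) := by
        rw [e2, c1]; simp only [mul_assoc]
    _ = ↑(Ju P (g + 2) ^ r) * seg (Xg P) (g + 2) (h + 2) * (seg (Xg P) i j * seg (Eg P) (h + 2) (m + 2)) * seg (Eg P) j m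
        := by rw [e3, c2]; simp only [mul_assoc]
    _ = _ := by rw [c3]; simp only [mul_assoc]

theorem arc_mul_arc_of_add_two_le {i j g h m : ℕ} (hi : 1 ≤ i) (hig : i ≤ g) (hgh : g ≤ h)
    (hhj : h ≤ j) (hjm : j + 1 ≤ m) (hn : m + 1 ≤ P.n - 1) :
    arc P i (j + 2) (m + 2) * arc P g h m = arc P (g + 1) (h + 1) (m + 2) * arc P i j m := by
  have c1 : seg (Eg P) (j + 2) (m + 2) * seg (Xg P) g h
      = seg (Xg P) g h * seg (Eg P) (j + 2) (m + 2) :=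
    (commute_pX_pE P (by omega)).symm
  have c2 : seg (Eg P) (j + 2) (m + 2) * seg (Eg P) h j
      = seg (Eg P) h j * seg (Eg P) (j + 2) (m + 2) :=
    commute_pE_pE P (by omega)
  have c3 : seg (Eg P) (j + 2) (m + 2) * Eg P j = Eg P j * seg (Eg P) (j + 2) (m + 2) :=
    (commute_seg _ fun t _ _ => commute_Eg_Eg P (by omega)).symm
  have c4 : seg (Xg P) i j * Eg P (j + 1) = Eg P (j + 1) * seg (Xg P) i j :=
    (commute_seg _ fun t _ _ => (commute_Xg_Eg P (by omega)).symm).symm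
  have c5 : seg (Xg P) i j * seg (Eg P) (j + 2) (m + 2)
      = seg (Eg P) (j + 2) (m + 2) * seg (Xg P) i j :=
    commute_pX_pE P (by omega)
  have s1 : seg (Xg P) i (j + 2) * seg (Xg P) g h
      = seg (Xg P) (g + 1) (h + 1) * seg (Xg P) i (j + 2) :=
    (semiconjBy_seg _ fun t _ _ => semiconjBy_pX_Xg P hi (by omega) (by omega) (by omega)).eq
  have s2 : seg (Xg P) i (j + 2) * seg (Eg P) h j
      = seg (Eg P) (h + 1) (j + 1) * seg (Xg P) i (j + 2) :=
    (semiconjBy_seg _ fun t _ _ => semiconjBy_pX_Eg P hi (by omega) (by omega) (by omega)).eq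
  have k1 : seg (Xg P) i (j + 2) * Eg P j = Eg P (j + 1) * seg (Xg P) i j * Eg P j := by
    rw [← seg_mul_seg _ (show i ≤ j by omega) (show j ≤ j + 2 by omega), seg_two, mul_assoc,
      XXE_up P (by omega) (by omega), ← mul_assoc, c4]
  have k2 : seg (Eg P) h j * (Eg P j * seg (Eg P) (j + 1) m) = seg (Eg P) h m := by
    rw [← seg_cons _ (show j < m by omega), seg_mul_seg _ hhj (by omega)]
  have k3 : seg (Eg P) (h + 1) (j + 1) * (Eg P (j + 1) * seg (Eg P) (j + 2) (m + 2))
      = seg (Eg P) (h + 1) (m + 2) := by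
    rw [← seg_cons _ (show j + 1 < m + 2 by omega), seg_mul_seg _ (by omega) (by omega)]
  have k4 : Eg P j * seg (Eg P) (j + 1) m
      = seg (Eg P) j m := (seg_cons _ (show j < m by omega)).symm
  simp only [arc]
  calc _ = seg (Xg P) i (j + 2) * (seg (Eg P) (j + 2) (m + 2) * seg (Xg P) g h) *
          (seg (Eg P) h j * (Eg P j * seg (Eg P) (j + 1) m)) := by rw [k2]; simp only [mul_assoc]
    _ = (seg (Xg P) i (j + 2) * seg (Xg P) g h) * (seg (Eg P) (j + 2) (m + 2) * seg (Eg P) h j) *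
          (Eg P j * seg (Eg P) (j + 1) m) := by rw [c1]; simp only [mul_assoc]
    _ = seg (Xg P) (g + 1) (h + 1) * (seg (Xg P) i (j + 2) * seg (Eg P) h j) * (seg (Eg P) (j + 2) (m + 2) * Eg P j) *
          seg (Eg P) (j + 1) m := by rw [s1, c2]; simp only [mul_assoc]
    _ = seg (Xg P) (g + 1) (h + 1) * seg (Eg P) (h + 1) (j + 1) * (seg (Xg P) i (j + 2) * Eg P j) *
          seg (Eg P) (j + 2) (m + 2) * seg (Eg P) (j + 1) m := by rw [s2, c3]; simp only [mul_assoc]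
    _ = seg (Xg P) (g + 1) (h + 1) * seg (Eg P) (h + 1) (j + 1) * (Eg P (j + 1) * seg (Xg P) i j) *
          (seg (Eg P) (j + 2) (m + 2) * Eg P j) * seg (Eg P) (j + 1) m := by
        rw [k1, c3]; simp only [mul_assoc]
    _ = seg (Xg P) (g + 1) (h + 1) * seg (Eg P) (h + 1) (j + 1) * Eg P (j + 1) *
          (seg (Xg P) i j * seg (Eg P) (j + 2) (m + 2)) * (Eg P j * seg (Eg P) (j + 1) m) := by
        simp only [mul_assoc]
    _ = seg (Xg P) (g + 1) (h + 1) * (seg (Eg P) (h + 1) (j + 1) * (Eg P (j + 1) * seg (Eg P) (j + 2) (m + 2))) *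
          (seg (Xg P) i j * seg (Eg P) j m) := by rw [c5, k4]; simp only [mul_assoc]
    _ = _ := by rw [k3]

theorem arc_mul_arc_of_le {i j g h m : ℕ} (hi : 1 ≤ i) (hig : i ≤ g) (hgj : g ≤ j)
    (hjh : j ≤ h) (hhm : h + 1 ≤ m) (hn : m + 1 ≤ P.n - 1) :
    arc P i (j + 1) (m + 2) * arc P g h m = seg (Xg P) (g + 1) (j + 1) * Xgi P (j + 1) *
      (arc P (j + 2) (h + 2) (m + 2) * arc P i j m) := by
  have c1 : seg (Eg P) (j + 1) (m + 2) * seg (Xg P) g j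
      = seg (Xg P) g j * seg (Eg P) (j + 1) (m + 2) :=
    (commute_pX_pE P (by omega)).symm
  have c2 : seg (Xg P) i j * Xgi P (j + 1) = Xgi P (j + 1) * seg (Xg P) i j :=
    commute_Xgi P (commute_seg _ fun t _ _ => commute_Xg_Xg P (by omega)).symm
  have s1 : seg (Xg P) i (j + 1) * seg (Xg P) g j
      = seg (Xg P) (g + 1) (j + 1) * seg (Xg P) i (j + 1) :=
    (semiconjBy_seg _ fun t _ _ => semiconjBy_pX_Xg P hi (by omega) (by omega) (by omega)).eq
  have k1 : seg (Xg P) i (j + 1) * seg (Eg P) (j + 1) (m + 2)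
      = Xgi P (j + 1) * arc P i j (m + 2) := by
    rw [arc, seg_snoc _ (show i ≤ j by omega), seg_cons _ (show j + 1 < m + 2 by omega),
      seg_cons _ (show j < m + 2 by omega), seg_cons _ (show j + 1 < m + 2 by omega),
      mul_assoc, ← mul_assoc (Xg P j), ← Xgi_mul_Eg_mul_Eg P (by omega) (by omega)]
    simp only [mul_assoc]
    rw [← mul_assoc, c2, mul_assoc]
  have k2 := arc_mul_Ju_mul_arc P hi (hig.trans hgj) le_rfl hjh hhm hn 0
  rw [zpow_zero, zpow_zero, Units.val_one, one_mul, one_mul] at k2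
  rw [← k2]
  calc _ = seg (Xg P) i (j + 1) * (seg (Eg P) (j + 1) (m + 2) * seg (Xg P) g j) * arc P j h m := by
        simp only [arc]; rw [← seg_mul_seg _ hgj hjh]; simp only [mul_assoc]
    _ = (seg (Xg P) i (j + 1) * seg (Xg P) g j) * seg (Eg P) (j + 1) (m + 2) * arc P j h m := by
        rw [c1]; simp only [mul_assoc]
    _ = seg (Xg P) (g + 1) (j + 1) * (seg (Xg P) i (j + 1) * seg (Eg P) (j + 1) (m + 2)) * arc P j h m := by
        rw [s1]; simp only [mul_assoc]
    _ = _ := by rw [k1]; simp only [mul_assoc]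

theorem Eg_mul_arc {t j l : ℕ} (ht : 1 ≤ t) (htj : t < j) (hjl : j ≤ l) (hn : l ≤ P.n - 1) :
    ∃ y ∈ Submonoid.closure {x | ∃ s, t ≤ s ∧ s + 2 ≤ l ∧ x = Xgi P s},
      Eg P t * arc P (t + 1) j (l + 1) = seg (Eg P) t (l + 1) * y := by
  obtain ⟨j, rfl⟩ := Nat.exists_eq_add_of_le' (show 1 ≤ j by omega)
  have hm : t ≤ j := by omega
  induction hm using Nat.decreasingInduction with
  | self =>
    refine ⟨1, one_mem _, ?_⟩
    rw [arc, seg_self, one_mul, mul_one, seg_cons _ (show j < l + 1 by omega)]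
  | of_succ t ht' ih =>
    obtain ⟨y, hy, e⟩ := ih (by omega) (by omega)
    refine ⟨y * Xgi P t, mul_mem (Submonoid.closure_mono ?_ hy)
      (Submonoid.subset_closure ⟨t, le_rfl, by omega, rfl⟩), ?_⟩
    · rintro x ⟨s, h1, h2, rfl⟩
      exact ⟨s, by omega, h2, rfl⟩
    · have c : Commute (arc P (t + 1 + 1) (j + 1) (l + 1)) (Xgi P t) :=
        commute_Xgi P (Commute.mul_left
          (commute_seg _ fun s _ _ => commute_Xg_Xg P (by omega)).symm
          (commute_seg _ fun s _ _ => commute_Xg_Eg P (by omega)).symm)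
      rw [← mul_assoc, seg_cons _ (show t < l + 1 by omega), mul_assoc (Eg P t), ← e, mul_assoc,
        mul_assoc, c.eq, ← mul_assoc, ← mul_assoc,
        ← Eg_mul_Xg_succ P ht (by omega), arc, seg_cons _ (show t + 1 < j + 1 by omega), arc]
      simp only [mul_assoc]

end CBMW

/-- `s` lies between `0` and `p`. -/
def IsBetweenZero (p s : ℤ) : Prop := (0 ≤ s ∧ s ≤ p) ∨ (p ≤ s ∧ s ≤ 0)

namespace IsRankTwo

variable {R A : Type*} [CommRing R] [Ring A] [Algebra R A]
  {δ : R} {lam : Rˣ} {x a b : Aˣ} {e : A}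

theorem b_zpow_mul_e (H : IsRankTwo δ lam x a b e) (d : ℤ) :
    (↑(b ^ d) : A) * e = ↑(a ^ (-d)) * e := by
  obtain ⟨m, rfl | rfl⟩ := d.eq_nat_or_neg
  · rw [zpow_natCast, H.b_pow_mul_e, inv_pow, zpow_neg, zpow_natCast]
  · have := H.inv.b_pow_mul_e m
    rwa [inv_inv, inv_pow, ← zpow_natCast b, ← zpow_neg, ← zpow_natCast a,
      ← neg_neg (m : ℤ), neg_neg (-(m : ℤ))] at this

theorem e_mul_b_zpow (H : IsRankTwo δ lam x a b e) (d : ℤ) :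
    e * (↑(b ^ d) : A) = e * ↑(a ^ (-d)) := by
  obtain ⟨m, rfl | rfl⟩ := d.eq_nat_or_neg
  · rw [zpow_natCast, H.e_mul_b_pow, inv_pow, zpow_neg, zpow_natCast]
  · have := H.inv.e_mul_b_pow m
    rwa [inv_inv, inv_pow, ← zpow_natCast b, ← zpow_neg, ← zpow_natCast a,
      ← neg_neg (m : ℤ), neg_neg (-(m : ℤ))] at this

theorem comm_zpow (H : IsRankTwo δ lam x a b e) (c d : ℤ) :
    (↑(a ^ c) : A) * ↑(b ^ d) = ↑(b ^ d) * ↑(a ^ c) :=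
  congrArg Units.val ((H.comm.zpow_zpow c d).eq)

theorem b_mul_x (H : IsRankTwo δ lam x a b e) :
    (b : A) * x = x * a + δ • (b : A) - δ • (b * e) := by
  have h1 : (b : A) * ↑x⁻¹ = x * a := by
    rw [H.b_eq]; push_cast; rw [Units.mul_inv_cancel_right]
  rw [← h1, H.x_eq]
  simp only [mul_add, mul_sub, mul_smul_comm, mul_one]

theorem binv_mul_x (H : IsRankTwo δ lam x a b e) :
    (↑b⁻¹ : A) * x = x * ↑a⁻¹ - δ • (↑a⁻¹ : A) + δ • (e * ↑a⁻¹) := by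
  have h1 : (↑b⁻¹ : A) * x = ↑x⁻¹ * ↑a⁻¹ := by
    rw [H.b_eq, mul_inv_rev, mul_inv_rev]; push_cast
    rw [← mul_assoc, Units.inv_mul_cancel_right]
  rw [h1, H.xinv_eq]
  simp only [add_mul, sub_mul, smul_mul_assoc, one_mul]

theorem x_mul_x (H : IsRankTwo δ lam x a b e) :
    (x : A) * x = 1 + δ • (x : A) - (δ * lam) • e := by
  conv_lhs => rw [H.x_eq]
  conv_lhs => enter [2]; rw [← one_mul (↑x⁻¹ + δ • 1 - δ • e : A), ← H.x_eq]
  rw [one_mul, sub_mul, add_mul, smul_mul_assoc, smul_mul_assoc, H.e_mul_x, Units.inv_mul, one_mul,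
    smul_smul]

/-- Replacing an inner `x` by `x⁻¹`. -/
theorem mem_of_inv (H : IsRankTwo δ lam x a b e) (N : Submodule R A) {w w' v : A}
    (h0 : w * (w' * (↑x⁻¹ * v)) ∈ N)
    (h1 : w * (w' * v) ∈ N) (h2 : w * (w' * (e * v)) ∈ N) : w * (w' * (x * v)) ∈ N := by
  have := H.mul_x_mem N (u := w * w') (v := v) (by simpa only [mul_assoc] using h0)
    (by simpa only [mul_assoc] using h1) (by simpa only [mul_assoc] using h2)
  simpa only [mul_assoc] using this

variable {N : Submodule R A} {v : A}

theorem smul_b_pow_mem (H : IsRankTwo δ lam x a b e) (hv : Commute (a : A) v)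
    (hR : ∀ w ∈ N, ∀ d : ℤ, w * ↑(a ^ d) ∈ N) (p : ℕ)
    (h1 : ∀ s : ℕ, s ≤ p → ↑(a ^ s) * (x * v) ∈ N)
    (h2 : ∀ s : ℕ, s ≤ p → ↑(a ^ s) * (e * v) ∈ N)
    (h3 : ∀ s : ℕ, s ≤ p → ↑(b ^ s) * v ∈ N) :
    x * (↑(b ^ p) * v) ∈ N ∧ ↑x⁻¹ * (↑(b ^ p) * v) ∈ N ∧ e * (↑(b ^ p) * v) ∈ N := by
  have va : ∀ d : ℤ, ↑(a ^ d) * v = v * ↑(a ^ d) := fun d => (hv.units_zpow_left d).eq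
  have van : ∀ s : ℕ, ↑(a ^ s) * v = v * ↑(a ^ s) := fun s => by
    simpa only [zpow_natCast] using va s
  have hRn : ∀ w ∈ N, ∀ s : ℕ, w * ↑(a ^ s) ∈ N := fun w hw s => by
    simpa only [zpow_natCast] using hR w hw s
  have he : ∀ s q : ℕ, s ≤ p → ↑(a ^ s) * (e * (↑(b ^ q) * v)) ∈ N := by
    intro s q hs
    rw [← zpow_natCast b, ← mul_assoc e, H.e_mul_b_zpow, mul_assoc, va, ← mul_assoc e,
      ← mul_assoc]
    exact hR _ (h2 s hs) _
  have he0 : e * (↑(b ^ p) * v) ∈ N := by simpa using he 0 p (Nat.zero_le _)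
  have hxi : ↑x⁻¹ * (↑(b ^ p) * v) ∈ N := by
    have := H.xinv_mul_b_pow_mem N (u := 1) (v := v) (p := p) ?_ ?_ ?_
    · simpa only [one_mul, mul_assoc] using this
    · refine H.mul_xinv_mem N ?_ ?_ ?_
      · simpa only [one_mul, mul_assoc] using h1 p le_rfl
      · rw [one_mul, van]
        exact hRn _ (by simpa using h3 0 (Nat.zero_le _)) _
      · simpa only [one_mul, mul_assoc] using h2 p le_rfl
    · intro s q hs hq
      have hc := H.comm_zpow s q
      rw [zpow_natCast, zpow_natCast] at hc
      rw [one_mul, hc, mul_assoc, van, ← mul_assoc]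
      exact hRn _ (h3 q (by omega)) _
    · intro s q hs hq
      simpa only [one_mul, mul_assoc] using he s q (by omega)
  refine ⟨?_, hxi, he0⟩
  have := H.mul_x_mem N (u := 1) (v := ↑(b ^ p) * v) (by simpa using hxi)
    (by simpa using h3 p le_rfl) (by simpa using he0)
  simpa using this

/-- `x`, `x⁻¹` and `e` applied to `b ^ p * v` when `a` commutes with `v`. -/
theorem smul_b_zpow_mem (H : IsRankTwo δ lam x a b e) (hv : Commute (a : A) v)
    (hR : ∀ w ∈ N, ∀ d : ℤ, w * ↑(a ^ d) ∈ N) (p : ℤ)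
    (h1 : ∀ s : ℤ, IsBetweenZero p s → ↑(a ^ s) * (x * v) ∈ N)
    (h2 : ∀ s : ℤ, IsBetweenZero p s → ↑(a ^ s) * (e * v) ∈ N)
    (h3 : ∀ s : ℤ, IsBetweenZero p s → ↑(b ^ s) * v ∈ N) :
    x * (↑(b ^ p) * v) ∈ N ∧ ↑x⁻¹ * (↑(b ^ p) * v) ∈ N ∧ e * (↑(b ^ p) * v) ∈ N := by
  obtain ⟨m, rfl | rfl⟩ := p.eq_nat_or_neg
  · rw [zpow_natCast]
    exact H.smul_b_pow_mem hv hR m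
      (fun s hs => by simpa only [zpow_natCast] using h1 s (Or.inl (by omega)))
      (fun s hs => by simpa only [zpow_natCast] using h2 s (Or.inl (by omega)))
      (fun s hs => by simpa only [zpow_natCast] using h3 s (Or.inl (by omega)))
  · have hva : ∀ d : ℤ, ↑(a ^ d) * v = v * ↑(a ^ d) := fun d => (hv.units_zpow_left d).eq
    have hv0 : v ∈ N := by simpa using h3 0 (Or.inr (by omega))
    have := H.inv.smul_b_pow_mem (N := N) (v := v) hv.units_inv_left
      (fun w hw d => by rw [inv_zpow']; exact hR w hw _) m
      (fun s hs => by
        have e0 : (a⁻¹) ^ s = a ^ (-(s : ℤ)) := by rw [zpow_neg, inv_pow, zpow_natCast]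
        rw [e0, ← mul_assoc]
        refine H.mul_xinv_mem N ?_ ?_ ?_
        · rw [mul_assoc]; exact h1 _ (Or.inr (by omega))
        · rw [hva]; exact hR _ hv0 _
        · rw [mul_assoc]; exact h2 _ (Or.inr (by omega)))
      (fun s hs => by
        rw [show (a⁻¹) ^ s = a ^ (-(s : ℤ)) by rw [zpow_neg, inv_pow, zpow_natCast]]
        exact h2 _ (Or.inr (by omega)))
      (fun s hs => by
        rw [show (b⁻¹) ^ s = b ^ (-(s : ℤ)) by rw [zpow_neg, inv_pow, zpow_natCast]]
        exact h3 _ (Or.inr (by omega)))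
    rw [inv_inv, show (b⁻¹) ^ m = b ^ (-(m : ℤ)) by rw [zpow_neg, inv_pow, zpow_natCast]] at this
    exact ⟨this.2.1, this.1, this.2.2⟩

theorem smul_a_pow_e_mem (H : IsRankTwo δ lam x a b e)
    (hz : ∀ d : ℤ, ∃ z, e * (↑(a ^ d) * (e * v)) = e * v * z ∧ ∀ w ∈ N, w * z ∈ N) (p : ℕ)
    (h1 : ∀ s : ℤ, |s| ≤ p → ↑(a ^ s) * (e * v) ∈ N) :
    x * (↑(a ^ p) * (e * v)) ∈ N ∧ ↑x⁻¹ * (↑(a ^ p) * (e * v)) ∈ N ∧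
      e * (↑(a ^ p) * (e * v)) ∈ N := by
  have he : ∀ s d : ℤ, |s| ≤ p → ↑(a ^ s) * (e * (↑(a ^ d) * (e * v))) ∈ N := by
    intro s d hs
    obtain ⟨z, hz1, hz2⟩ := hz d
    rw [hz1, ← mul_assoc]
    exact hz2 _ (h1 s hs)
  have he0 : e * (↑(a ^ p) * (e * v)) ∈ N := by
    simpa using he 0 p (by simp)
  have hx : x * (↑(a ^ p) * (e * v)) ∈ N := by
    have := H.x_mul_a_pow_mem N (u := 1) (v := e * v) (p := p) ?_ ?_ ?_
    · simpa only [one_mul, mul_assoc] using this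
    · rw [one_mul, mul_assoc, ← mul_assoc (x : A), H.x_mul_e, smul_mul_assoc, mul_smul_comm,
        ← zpow_natCast, ← mul_assoc, H.b_zpow_mul_e, mul_assoc]
      exact N.smul_mem _ (h1 _ (by simp))
    · intro s q hs hq
      have hc := H.comm_zpow q s
      rw [one_mul, ← zpow_natCast, ← zpow_natCast, ← hc, mul_assoc, ← mul_assoc _ e,
        H.b_zpow_mul_e, mul_assoc, ← mul_assoc, ← Units.val_mul, ← zpow_add]
      exact h1 _ (by rw [abs_le]; omega)
    · intro s q hs hq
      rw [one_mul, ← zpow_natCast, ← zpow_natCast, H.b_zpow_mul_e, mul_assoc, mul_assoc]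
      exact he _ _ (by rw [abs_le]; omega)
  refine ⟨hx, ?_, he0⟩
  have := H.mul_xinv_mem N (u := 1) (v := ↑(a ^ p) * (e * v)) (by simpa using hx)
    (by simpa only [one_mul, zpow_natCast] using h1 p (by simp)) (by simpa using he0)
  simpa using this

/-- `x`, `x⁻¹` and `e` applied to `a ^ p * e * v`. -/
theorem smul_a_zpow_e_mem (H : IsRankTwo δ lam x a b e)
    (hz : ∀ d : ℤ, ∃ z, e * (↑(a ^ d) * (e * v)) = e * v * z ∧ ∀ w ∈ N, w * z ∈ N) (p : ℤ)
    (h1 : ∀ s : ℤ, |s| ≤ |p| → ↑(a ^ s) * (e * v) ∈ N) :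
    x * (↑(a ^ p) * (e * v)) ∈ N ∧ ↑x⁻¹ * (↑(a ^ p) * (e * v)) ∈ N ∧
      e * (↑(a ^ p) * (e * v)) ∈ N := by
  obtain ⟨m, rfl | rfl⟩ := p.eq_nat_or_neg
  · rw [zpow_natCast]
    exact H.smul_a_pow_e_mem hz m (fun s hs => h1 s (by simpa using hs))
  · have := H.inv.smul_a_pow_e_mem (N := N) (v := v)
      (fun d => by rw [inv_zpow']; exact hz _) m
      (fun s hs => by rw [inv_zpow']; exact h1 _ (by simpa using hs))
    rw [inv_inv, show (a⁻¹) ^ m = a ^ (-(m : ℤ)) by rw [zpow_neg, inv_pow, zpow_natCast]] at this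
    exact ⟨this.2.1, this.1, this.2.2⟩

theorem smul_a_pow_x_mem (H : IsRankTwo δ lam x a b e) (hv : Commute (a : A) v)
    (hR : ∀ w ∈ N, ∀ d : ℤ, w * ↑(a ^ d) ∈ N)
    (hz : ∀ d : ℤ, ∃ z, e * (↑(a ^ d) * (e * v)) = e * v * z ∧ ∀ w ∈ N, w * z ∈ N) (p : ℕ)
    (h1 : ∀ s : ℤ, |s| ≤ p → ↑(a ^ s) * (e * v) ∈ N)
    (h2 : ∀ s : ℕ, s ≤ p → ↑(a ^ s) * (x * v) ∈ N)
    (h3 : ∀ s : ℕ, s ≤ p → ↑(b ^ s) * v ∈ N) :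
    x * (↑(a ^ p) * (x * v)) ∈ N ∧ ↑x⁻¹ * (↑(a ^ p) * (x * v)) ∈ N ∧
      e * (↑(a ^ p) * (x * v)) ∈ N := by
  have va : ∀ d : ℤ, ↑(a ^ d) * v = v * ↑(a ^ d) := fun d => (hv.units_zpow_left d).eq
  have hez : ∀ s d : ℤ, |s| ≤ p → ↑(a ^ s) * (e * (↑(a ^ d) * (e * v))) ∈ N := by
    intro s d hs
    obtain ⟨z, hz1, hz2⟩ := hz d
    rw [hz1, ← mul_assoc]
    exact hz2 _ (h1 s hs)
  have hev : ∀ s d : ℤ, |s| ≤ p → ↑(a ^ s) * (e * (↑(a ^ d) * v)) ∈ N := by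
    intro s d hs
    rw [va, ← mul_assoc e, ← mul_assoc]
    exact hR _ (h1 s hs) _
  have hex : ∀ (s : ℤ) (q : ℕ), |s| ≤ p → ↑(a ^ s) * (e * (↑(a ^ (q : ℤ)) * (x * v))) ∈ N := by
    intro s q hs
    induction q with
    | zero =>
      rw [Nat.cast_zero, zpow_zero, Units.val_one, one_mul, ← mul_assoc e, H.e_mul_x,
        smul_mul_assoc, mul_smul_comm]
      exact N.smul_mem _ (h1 s hs)
    | succ q ih =>
      have key : e * (↑(a ^ ((q + 1 : ℕ) : ℤ)) * (x * v))
          = e * (↑(a ^ (q : ℤ)) * (x * v)) * ↑(a ^ (-1 : ℤ))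
            - δ • (e * (↑(a ^ (q : ℤ)) * v) * ↑(a ^ (-1 : ℤ)))
            + δ • (e * (↑(a ^ (q : ℤ)) * (e * v)) * ↑(a ^ (-1 : ℤ))) := by
        have hb1 : e * ↑(a ^ ((q + 1 : ℕ) : ℤ)) = e * ↑(a ^ (q : ℤ)) * ↑b⁻¹ := by
          have := H.e_mul_b_zpow (-((q + 1 : ℕ) : ℤ))
          rw [neg_neg] at this
          rw [← this, show -((q + 1 : ℕ) : ℤ) = -(q : ℤ) + -1 by push_cast; ring, zpow_add,
            Units.val_mul, ← mul_assoc, H.e_mul_b_zpow, neg_neg, zpow_neg_one]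
        rw [← mul_assoc, hb1, ← mul_assoc, mul_assoc _ (↑b⁻¹ : A), H.binv_mul_x, zpow_neg_one]
        have hva : ↑a⁻¹ * v = v * ↑a⁻¹ := by simpa using va (-1)
        simp only [mul_add, mul_sub, add_mul, sub_mul, mul_smul_comm, smul_mul_assoc, mul_assoc,
          hva]
      have ha : ∀ w : A, ↑(a ^ s) * (w * ↑(a ^ (-1 : ℤ))) = ↑(a ^ s) * w * ↑(a ^ (-1 : ℤ)) :=
        fun w => (mul_assoc _ _ _).symm
      rw [key, mul_add, mul_sub, mul_smul_comm, mul_smul_comm, ha, ha, ha]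
      exact add_mem (sub_mem (hR _ ih _) (N.smul_mem _ (hR _ (hev s q hs) _)))
        (N.smul_mem _ (hR _ (hez s q hs) _))
  have hbe : ∀ s d : ℤ, ↑(a ^ s) * (↑(b ^ d) * (e * v)) = ↑(a ^ (s - d)) * (e * v) := by
    intro s d
    rw [← mul_assoc _ e, H.b_zpow_mul_e, mul_assoc, ← mul_assoc, ← Units.val_mul, ← zpow_add,
      sub_eq_add_neg]
  have hbx : ∀ s q : ℕ, q + s ≤ p → ↑(a ^ (q : ℤ)) * (↑(b ^ (s : ℤ)) * (x * v)) ∈ N := by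
    intro s q hsq
    induction s with
    | zero => simpa using h2 q (by omega)
    | succ s ih =>
      have key : ↑(a ^ (q : ℤ)) * (↑(b ^ ((s + 1 : ℕ) : ℤ)) * (x * v))
          = ↑(a ^ (q : ℤ)) * (↑(b ^ (s : ℤ)) * (x * v)) * ↑(a ^ (1 : ℤ))
            + δ • (↑(b ^ (s + 1)) * v * ↑(a ^ (q : ℤ)))
            - δ • (↑(a ^ (q : ℤ)) * (↑(b ^ ((s + 1 : ℕ) : ℤ)) * (e * v))) := by
        have hc : ↑(b ^ (s + 1)) * v * ↑(a ^ (q : ℤ))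
            = ↑(a ^ (q : ℤ)) * (↑(b ^ ((s + 1 : ℕ) : ℤ)) * v) := by
          rw [mul_assoc, ← va, ← mul_assoc, ← zpow_natCast b, ← H.comm_zpow, mul_assoc]
        have hb1 : (↑(b ^ ((s + 1 : ℕ) : ℤ)) : A) = ↑(b ^ (s : ℤ)) * b := by
          rw [Nat.cast_succ, zpow_add_one, Units.val_mul]
        rw [hc, hb1, mul_assoc _ (b : A), ← mul_assoc (b : A) (x : A), H.b_mul_x, zpow_one]
        simp only [mul_add, mul_sub, add_mul, sub_mul, mul_smul_comm, smul_mul_assoc, mul_assoc,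
          hv.eq]
      rw [key, hbe]
      refine sub_mem (add_mem (hR _ (ih (by omega)) _) (N.smul_mem _ (hR _ (h3 _ (by omega)) _)))
        (N.smul_mem _ (h1 _ ?_))
      rw [abs_le]; omega
  have he0 : e * (↑(a ^ p) * (x * v)) ∈ N := by
    simpa using hex 0 p (by simp)
  have hx : x * (↑(a ^ p) * (x * v)) ∈ N := by
    have := H.x_mul_a_pow_mem N (u := 1) (v := x * v) (p := p) ?_ ?_ ?_
    · simpa only [one_mul, mul_assoc] using this
    · rw [one_mul, mul_assoc, ← mul_assoc (x : A), H.x_mul_x, sub_mul, add_mul, one_mul,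
        smul_mul_assoc, smul_mul_assoc, mul_sub, mul_add, mul_smul_comm, mul_smul_comm]
      refine sub_mem (add_mem (h3 p le_rfl) (N.smul_mem _ ?_)) (N.smul_mem _ ?_)
      · simpa using hbx p 0 (by omega)
      · have := hbe 0 p
        rw [zpow_zero, Units.val_one, one_mul, zpow_natCast] at this
        rw [this]
        exact h1 _ (by simp)
    · intro s q hs hq
      have hc := H.comm_zpow q s
      rw [one_mul, ← zpow_natCast, ← zpow_natCast, ← hc, mul_assoc]
      exact hbx s q (by omega)
    · intro s q hs hq
      rw [one_mul, ← zpow_natCast, ← zpow_natCast, H.b_zpow_mul_e, mul_assoc, mul_assoc]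
      exact hex _ _ (by rw [abs_le]; omega)
  refine ⟨hx, ?_, he0⟩
  have := H.mul_xinv_mem N (u := 1) (v := ↑(a ^ p) * (x * v)) (by simpa using hx)
    (by simpa only [one_mul] using h2 p le_rfl) (by simpa using he0)
  simpa using this

/-- `x`, `x⁻¹` and `e` applied to `a ^ p * x * v` when `a` commutes with `v`. -/
theorem smul_a_zpow_x_mem (H : IsRankTwo δ lam x a b e) (hv : Commute (a : A) v)
    (hR : ∀ w ∈ N, ∀ d : ℤ, w * ↑(a ^ d) ∈ N)
    (hz : ∀ d : ℤ, ∃ z, e * (↑(a ^ d) * (e * v)) = e * v * z ∧ ∀ w ∈ N, w * z ∈ N) (p : ℤ)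
    (h1 : ∀ s : ℤ, |s| ≤ |p| → ↑(a ^ s) * (e * v) ∈ N)
    (h2 : ∀ s : ℤ, |s| ≤ |p| → ↑(a ^ s) * (x * v) ∈ N)
    (h3 : ∀ s : ℤ, IsBetweenZero p s → ↑(b ^ s) * v ∈ N) :
    x * (↑(a ^ p) * (x * v)) ∈ N ∧ ↑x⁻¹ * (↑(a ^ p) * (x * v)) ∈ N ∧
      e * (↑(a ^ p) * (x * v)) ∈ N := by
  obtain ⟨m, rfl | rfl⟩ := p.eq_nat_or_neg
  · rw [zpow_natCast]
    exact H.smul_a_pow_x_mem hv hR hz m (fun s hs => h1 s (by simpa using hs))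
      (fun s hs => by simpa only [zpow_natCast] using h2 s (by simpa using hs))
      (fun s hs => by simpa only [zpow_natCast] using h3 s (Or.inl (by omega)))
  · have va : ∀ d : ℤ, ↑(a ^ d) * v = v * ↑(a ^ d) := fun d => (hv.units_zpow_left d).eq
    have hv0 : v ∈ N := by simpa using h3 0 (Or.inr (by omega))
    have hxi : ∀ s : ℤ, |s| ≤ m → ↑(a ^ s) * (↑x⁻¹ * v) ∈ N := fun s hs => by
      rw [← mul_assoc]
      refine H.mul_xinv_mem N ?_ ?_ ?_
      · rw [mul_assoc]; exact h2 _ (by simpa using hs)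
      · rw [va]; exact hR _ hv0 _
      · rw [mul_assoc]; exact h1 _ (by simpa using hs)
    have e0 : ∀ s : ℕ, (a⁻¹) ^ s = a ^ (-(s : ℤ)) := fun s => by
      rw [zpow_neg, inv_pow, zpow_natCast]
    have := H.inv.smul_a_pow_x_mem (N := N) (v := v) hv.units_inv_left
      (fun w hw d => by rw [inv_zpow']; exact hR w hw _)
      (fun d => by rw [inv_zpow']; exact hz _) m
      (fun s hs => by rw [inv_zpow']; exact h1 _ (by simpa using hs))
      (fun s hs => by rw [e0]; exact hxi _ (by simpa using hs))
      (fun s hs => by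
        rw [show (b⁻¹) ^ s = b ^ (-(s : ℤ)) by rw [zpow_neg, inv_pow, zpow_natCast]]
        exact h3 _ (Or.inr (by omega)))
    have h4 := H.smul_a_zpow_e_mem hz (-m) h1
    rw [inv_inv, e0] at this
    refine ⟨H.mem_of_inv N this.2.1 ?_ h4.1, H.mem_of_inv N this.1 ?_ h4.2.1,
      H.mem_of_inv N this.2.2 ?_ h4.2.2⟩
    · rw [va, ← mul_assoc]
      exact hR _ (by simpa using h2 0 (by simp)) _
    · rw [va, ← mul_assoc]
      exact hR _ (by simpa using hxi 0 (by simp)) _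
    · rw [va, ← mul_assoc]
      exact hR _ (by simpa using h1 0 (by simp)) _

end IsRankTwo

namespace IsRankTwo

variable {R A : Type*} [CommRing R] [Ring A] [Algebra R A]
  {δ : R} {lam : Rˣ} {x a b : Aˣ} {e : A} {N : Submodule R A} {f : A} {y : Aˣ} {c : R}

theorem mul_b_pow_mul_mem (H : IsRankTwo δ lam x a b e)
    (hfx : f * x = f * e * ↑y⁻¹) (hxf : ↑x⁻¹ * f = y * e * f) (hfef : f * e * f = f)
    (hfxf : f * ↑x⁻¹ * f = c • f)
    (hya : Commute (y : A) a) (hfa : Commute (a : A) f) (hf : f ∈ N)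
    (hR : ∀ w ∈ N, ∀ d : ℤ, w * ↑(a ^ d) ∈ N)
    (hz : ∀ d : ℤ, ∃ z, e * ↑(a ^ d) * e = e * z ∧ Commute f z ∧ ∀ w ∈ N, w * z ∈ N) (p : ℕ) :
    f * ↑(b ^ p) * f ∈ N := by
  have fa : ∀ d : ℤ, ↑(a ^ d) * f = f * ↑(a ^ d) := fun d => (hfa.units_zpow_left d).eq
  have hfa' : ∀ d : ℤ, f * ↑(a ^ d) ∈ N := hR f hf
  have eb : ∀ d : ℕ, e * ↑(b ^ d) = e * ↑(a ^ (-(d : ℤ))) := fun d => by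
    rw [← zpow_natCast, H.e_mul_b_zpow]
  have be : ∀ d : ℕ, ↑(b ^ d) * e = ↑(a ^ (-(d : ℤ))) * e := fun d => by
    rw [← zpow_natCast, H.b_zpow_mul_e]
  have hc : ∀ s q : ℕ, (↑(a ^ s) : A) * ↑(b ^ q) = ↑(b ^ q) * ↑(a ^ s) := fun s q => by
    simpa only [zpow_natCast] using H.comm_zpow s q
  have feaf : ∀ d d' : ℤ, f * (↑(a ^ d) * (e * (↑(a ^ d') * f))) ∈ N := by
    intro d d'
    have : f * (↑(a ^ d) * (e * (↑(a ^ d') * f))) = f * ↑(a ^ d) * ↑(a ^ d') := by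
      rw [fa, ← mul_assoc, ← fa, mul_assoc, ← mul_assoc e, ← mul_assoc f, ← mul_assoc f, hfef,
        ← mul_assoc]
    rw [this]
    exact hR _ (hfa' d) _
  have feaef : ∀ d d' : ℤ, f * (↑(a ^ d) * (e * (↑(a ^ d') * (e * f)))) ∈ N := by
    intro d d'
    obtain ⟨z, hz1, hz2, hz3⟩ := hz d'
    have : f * (↑(a ^ d) * (e * (↑(a ^ d') * (e * f)))) = f * ↑(a ^ d) * z := by
      have e1 : e * (↑(a ^ d') * (e * f)) = e * (f * z) := by
        rw [hz2.eq, ← mul_assoc, ← mul_assoc, hz1, mul_assoc]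
      rw [e1, ← mul_assoc, ← fa, mul_assoc, ← mul_assoc e, ← mul_assoc f, ← mul_assoc f, hfef,
        ← mul_assoc]
    rw [this]
    exact hz3 _ (hfa' d)
  have faf : ∀ w : A, ∀ s : ℕ, w * (f * ↑(a ^ (s : ℤ))) = w * f * ↑(a ^ (s : ℤ)) :=
    fun w s => (mul_assoc _ _ _).symm
  have fxaef : ∀ s : ℕ, f * (x * (↑(a ^ s) * (e * f))) ∈ N := by
    intro s
    have := H.x_mul_a_pow_mem N (u := f) (v := e * f) (p := s) ?_ ?_ ?_
    · simpa only [mul_assoc] using this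
    · have e1 : f * ↑(b ^ s) * ↑x * (e * f)
          = (lam : R) • (f * (↑(a ^ (-(s : ℤ))) * (e * (↑(a ^ (0 : ℤ)) * f)))) := by
        rw [mul_assoc _ (x : A), ← mul_assoc (x : A), H.x_mul_e, smul_mul_assoc, mul_smul_comm,
          mul_assoc, ← mul_assoc _ e, be, zpow_zero, Units.val_one, one_mul, mul_assoc]
      rw [e1]
      exact N.smul_mem _ (feaf _ _)
    · intro s q _ _
      have e1 : f * ↑(b ^ s) * ↑(a ^ q) * (e * f)
          = f * (↑(a ^ ((q : ℤ) + -(s : ℤ))) * (e * (↑(a ^ (0 : ℤ)) * f))) := by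
        rw [mul_assoc f, ← hc, zpow_add, Units.val_mul, zpow_zero, Units.val_one, one_mul,
          mul_assoc, mul_assoc, ← mul_assoc _ e, be, mul_assoc, mul_assoc, zpow_natCast]
      rw [e1]
      exact feaf _ _
    · intro s q _ _
      rw [mul_assoc f, be, ← zpow_natCast]
      simpa only [mul_assoc] using feaef _ _
  induction p using Nat.strong_induction_on with
  | _ p ih =>
  have fbaf : ∀ s q : ℕ, q < p → f * (↑(a ^ s) * (↑(b ^ q) * f)) ∈ N := by
    intro s q hq
    have := hR _ (ih q hq) s
    rwa [mul_assoc, ← fa, zpow_natCast, mul_assoc, ← mul_assoc _ _ f, ← hc, mul_assoc] at this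
  have fxib : ∀ q : ℕ, q < p → f * ↑x⁻¹ * ↑(b ^ q) * f ∈ N := by
    intro q hq
    refine H.xinv_mul_b_pow_mem N ?_ ?_ ?_
    · rw [← zpow_natCast, ← fa, mul_assoc, mul_assoc, ← mul_assoc f, hfxf, mul_smul_comm, fa]
      exact N.smul_mem _ (hfa' _)
    · intro s q' hs hq'
      simpa only [mul_assoc] using fbaf s q' (by omega)
    · intro s q' hs hq'
      rw [mul_assoc _ e, eb, ← zpow_natCast]
      simpa only [mul_assoc] using feaf s (-q')
  have fxb : ∀ q : ℕ, q < p → f * (x * (↑(b ^ q) * f)) ∈ N := by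
    intro q hq
    have := H.mul_x_mem N (u := f) (v := ↑(b ^ q) * f) ?_ ?_ ?_
    · simpa only [mul_assoc] using this
    · simpa only [mul_assoc] using fxib q hq
    · simpa only [mul_assoc] using ih q hq
    · rw [mul_assoc, ← mul_assoc e, eb]
      simpa [mul_assoc] using feaf 0 (-q)
  have := H.xinv_mul_b_pow_mem N (u := f * x) (v := f) (p := p) ?_ ?_ ?_
  · rwa [Units.mul_inv_cancel_right] at this
  · have e1 : f * ↑x * ↑(a ^ p) * ↑x⁻¹ * f
        = f * (↑(a ^ (0 : ℤ)) * (e * (↑(a ^ (p : ℤ)) * (e * f)))) := by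
      have hy : (↑y⁻¹ : A) * (↑(a ^ p) * y) = ↑(a ^ p) := by
        have : (y : A) * ↑(a ^ p) = ↑(a ^ p) * y := by
          simpa only [zpow_natCast] using (hya.units_zpow_right (p : ℤ)).eq
        rw [← this, Units.inv_mul_cancel_left]
      rw [hfx, mul_assoc _ _ f, hxf, zpow_zero, Units.val_one, one_mul, zpow_natCast]
      conv_rhs => rw [← hy]
      simp only [mul_assoc]
    rw [e1]
    exact feaef _ _
  · intro s q hs hq
    have := hR _ (fxb q (by omega)) s
    have e1 : f * ↑x * ↑(a ^ s) * ↑(b ^ q) * f = f * (x * (↑(b ^ q) * f)) * ↑(a ^ (s : ℤ)) := by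
      rw [mul_assoc _ _ (↑(b ^ q) : A), hc]
      simp only [mul_assoc]
      rw [← fa, zpow_natCast]
    rwa [e1]
  · intro s q hs hq
    have := hR _ (fxaef s) (-q)
    have e1 : f * ↑x * ↑(a ^ s) * e * ↑(b ^ q) * f
        = f * (x * (↑(a ^ s) * (e * f))) * ↑(a ^ (-(q : ℤ))) := by
      rw [mul_assoc _ e, eb]
      simp only [mul_assoc]
      rw [← fa]
    rwa [e1]

theorem mul_b_zpow_mul_mem (H : IsRankTwo δ lam x a b e)
    (hfx : f * x = f * e * ↑y⁻¹) (hxf : ↑x⁻¹ * f = y * e * f)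
    (hfx' : f * ↑x⁻¹ = f * e * y) (hxf' : x * f = ↑y⁻¹ * e * f) (hfef : f * e * f = f)
    (hyf : ↑y * f = (lam : R) • f)
    (hya : Commute (y : A) a) (hfa : Commute (a : A) f) (hf : f ∈ N)
    (hR : ∀ w ∈ N, ∀ d : ℤ, w * ↑(a ^ d) ∈ N)
    (hz : ∀ d : ℤ, ∃ z, e * ↑(a ^ d) * e = e * z ∧ Commute f z ∧ ∀ w ∈ N, w * z ∈ N) (p : ℤ) :
    f * ↑(b ^ p) * f ∈ N := by
  have hyf' : (↑y⁻¹ : A) * f = ((lam⁻¹ : Rˣ) : R) • f := by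
    rw [Units.inv_mul_eq_iff_eq_mul, mul_smul_comm, hyf, smul_smul, Units.inv_mul, one_smul]
  obtain ⟨m, rfl | rfl⟩ := p.eq_nat_or_neg
  · rw [zpow_natCast]
    exact H.mul_b_pow_mul_mem hfx hxf hfef
      (by rw [hfx', mul_assoc, hyf, mul_smul_comm, hfef]) hya hfa hf hR hz m
  · have := H.inv.mul_b_pow_mul_mem (N := N) (y := y⁻¹) (by rw [inv_inv]; exact hfx')
      (by rw [inv_inv]; exact hxf') hfef
      (by rw [inv_inv, hfx, mul_assoc, hyf', mul_smul_comm, hfef])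
      hya.units_inv_left.units_inv_right hfa.units_inv_left hf
      (fun w hw d => by rw [inv_zpow']; exact hR w hw _)
      (fun d => by rw [inv_zpow']; exact hz _) m
    rwa [show (b⁻¹) ^ m = b ^ (-(m : ℤ)) by rw [zpow_neg, inv_pow, zpow_natCast]] at this

end IsRankTwo

namespace CBMW

variable {R : Type} [CommRing R] (P : Params R)

theorem Yg_mem_Bsub (l : ℕ) : Yg P ∈ Bsub P l := Algebra.subset_adjoin (by simp)

theorem Ygi_mem_Bsub (l : ℕ) : Ygi P ∈ Bsub P l := Algebra.subset_adjoin (by simp)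

theorem Xg_mem_Bsub {i l : ℕ} (h : i + 1 ≤ l) : Xg P i ∈ Bsub P l := by
  rcases Nat.eq_zero_or_pos i with rfl | hi
  · rw [Xg_invalid P (Or.inl rfl)]; exact one_mem _
  · exact Algebra.subset_adjoin (Or.inr ⟨i, hi, h, Or.inl rfl⟩)

theorem Xgi_mem_Bsub {i l : ℕ} (h : i + 1 ≤ l) : Xgi P i ∈ Bsub P l := by
  rcases Nat.eq_zero_or_pos i with rfl | hi
  · rw [← val_inv_Xu, Xu_zero, inv_one]; exact one_mem _
  · exact Algebra.subset_adjoin (Or.inr ⟨i, hi, h, Or.inr (Or.inl rfl)⟩)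

theorem Eg_mem_Bsub {i l : ℕ} (h : i + 1 ≤ l) : Eg P i ∈ Bsub P l := by
  rcases Nat.eq_zero_or_pos i with rfl | hi
  · rw [Eg_invalid P (Or.inl rfl)]; exact zero_mem _
  · exact Algebra.subset_adjoin (Or.inr ⟨i, hi, h, Or.inr (Or.inr rfl)⟩)

theorem Bsub_mono {l m : ℕ} (h : l ≤ m) : Bsub P l ≤ Bsub P m := by
  refine Algebra.adjoin_mono (Set.union_subset_union_right _ ?_)
  rintro x ⟨i, h1, h2, h3⟩
  exact ⟨i, h1, h2.trans h, h3⟩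

theorem Ju_mem_Bsub_and (i : ℕ) : (Ju P i : Alg P) ∈ Bsub P i ∧
    (↑(Ju P i)⁻¹ : Alg P) ∈ Bsub P i := by
  induction i with
  | zero => exact ⟨Yg_mem_Bsub P 0, Ygi_mem_Bsub P 0⟩
  | succ i ih =>
    have hX := Xg_mem_Bsub P (le_refl (i + 1))
    have hXi := Xgi_mem_Bsub P (le_refl (i + 1))
    have hm := Bsub_mono P (Nat.le_succ i)
    rw [Ju_succ, mul_inv_rev, mul_inv_rev]
    exact ⟨mul_mem (mul_mem hX (hm ih.1)) hX, mul_mem hXi (mul_mem (hm ih.2) hXi)⟩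

theorem Ju_zpow_mem_Bsub {i l : ℕ} (h : i ≤ l) (d : ℤ) : (↑(Ju P i ^ d) : Alg P) ∈ Bsub P l := by
  refine Bsub_mono P h ?_
  obtain ⟨m, rfl | rfl⟩ := d.eq_nat_or_neg
  · rw [zpow_natCast, Units.val_pow_eq_pow_val]
    exact pow_mem (Ju_mem_Bsub_and P i).1 m
  · rw [zpow_neg, zpow_natCast, ← inv_pow, Units.val_pow_eq_pow_val]
    exact pow_mem (Ju_mem_Bsub_and P i).2 m

theorem commute_of_mem_Bsub {c w : Alg P} {m : ℕ} (hc : c ∈ Bsub P m) (hY : Commute w (Yg P))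
    (hX : ∀ s, 1 ≤ s → s + 1 ≤ m → Commute w (Xg P s))
    (hE : ∀ s, 1 ≤ s → s + 1 ≤ m → Commute w (Eg P s)) : Commute w c := by
  have : Bsub P m ≤ Subalgebra.centralizer R {w} := by
    refine Algebra.adjoin_le ?_
    rintro x ((rfl | rfl) | ⟨s, h1, h2, rfl | rfl | rfl⟩) <;>
      simp only [Subalgebra.coe_centralizer, Set.mem_centralizer_iff, Set.mem_singleton_iff, forall_eq]
    · exact hY.eq
    · exact (Commute.units_inv_right (u := Yu P) hY).eq
    · exact (hX s h1 h2).eq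
    · exact (commute_Xgi P (hX s h1 h2)).eq
    · exact (hE s h1 h2).eq
  exact (Subalgebra.mem_centralizer_iff R).1 (this hc) w rfl

theorem commute_seg_of_mem_Bsub {c : Alg P} {m i j : ℕ} (hc : c ∈ Bsub P m) (hi : 2 ≤ i)
    (h : m + 1 ≤ i) : Commute (seg (Xg P) i j) c ∧ Commute (seg (Eg P) i j) c := by
  constructor
  · refine commute_of_mem_Bsub P hc ?_ (fun s _ hs => ?_) (fun s _ hs => ?_)
    · exact (commute_seg _ fun t _ _ => commute_Yg_Xg P (by omega)).symm
    · exact (commute_seg _ fun t _ _ => commute_Xg_Xg P (by omega)).symm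
    · exact (commute_seg _ fun t _ _ => (commute_Xg_Eg P (by omega)).symm).symm
  · refine commute_of_mem_Bsub P hc ?_ (fun s _ hs => ?_) (fun s _ hs => ?_)
    · exact (commute_seg _ fun t _ _ => commute_Yg_Eg P (by omega)).symm
    · exact (commute_seg _ fun t _ _ => commute_Xg_Eg P (by omega)).symm
    · exact (commute_seg _ fun t _ _ => commute_Eg_Eg P (by omega)).symm

theorem commute_arc_of_mem_Bsub {c : Alg P} {m i j l : ℕ} (hc : c ∈ Bsub P m) (hi : 2 ≤ i)
    (hij : i ≤ j) (h : m + 1 ≤ i) : Commute (arc P i j l) c :=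
  (commute_seg_of_mem_Bsub P hc hi h).1.mul_left
    (commute_seg_of_mem_Bsub P hc (hi.trans hij) (h.trans hij)).2

theorem commute_Ju_zpow_of_mem_Bsub {c : Alg P} {m i : ℕ} (hc : c ∈ Bsub P m) (h : m + 1 ≤ i)
    (hn : i ≤ P.n) (d : ℤ) : Commute ↑(Ju P i ^ d) c :=
  Commute.units_zpow_left (commute_of_mem_Bsub P hc (commute_Yg_Ju P i).symm
    (fun s h1 h2 => (commute_Xg_Ju_of_gt P h1 (by omega) (by omega)).symm)
    (fun s h1 h2 => (commute_Eg_Ju_of_gt P h1 (by omega) (by omega)).symm)) d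

/-- Every power of `Y` is a combination of `k` prescribed consecutive powers. -/
theorem Yu_zpow_mem_span (hq0 : P.qc 0 = (P.q0 : R)) (hk : 1 ≤ P.k) (c d : ℤ) :
    (↑(Yu P ^ d) : Alg P) ∈
      Submodule.span R ((fun s : ℤ => (↑(Yu P ^ s) : Alg P)) '' Set.Ico c (c + P.k)) := by
  set S := Submodule.span R ((fun s : ℤ => (↑(Yu P ^ s) : Alg P)) '' Set.Ico c (c + P.k))
  have hS : ∀ s : ℤ, c ≤ s → s < c + P.k → (↑(Yu P ^ s) : Alg P) ∈ S := fun s h1 h2 =>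
    Submodule.subset_span ⟨s, ⟨h1, h2⟩, rfl⟩
  have hrec : ∀ m : ℤ, (↑(Yu P ^ (m + P.k)) : Alg P)
      = ∑ i ∈ Finset.range P.k, P.qc i • (↑(Yu P ^ (m + i)) : Alg P) := by
    intro m
    rw [zpow_add, Units.val_mul, zpow_natCast, Units.val_pow_eq_pow_val, val_Yu, cyclo,
      Finset.mul_sum]
    refine Finset.sum_congr rfl fun i _ => ?_
    rw [mul_smul_comm, zpow_add, Units.val_mul, zpow_natCast, Units.val_pow_eq_pow_val, val_Yu]
  have hup : ∀ N : ℕ, ∀ s : ℤ, c ≤ s → s < c + P.k + N → (↑(Yu P ^ s) : Alg P) ∈ S := by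
    intro N
    induction N with
    | zero => intro s h1 h2; exact hS s h1 (by simpa using h2)
    | succ N ih =>
      intro s h1 h2
      rcases lt_or_ge s (c + P.k) with h | h
      · exact hS s h1 h
      rw [show s = (s - P.k) + P.k by ring, hrec]
      refine sum_mem fun i hi => S.smul_mem _ (ih _ ?_ ?_) <;>
      · have := Finset.mem_range.1 hi
        push_cast at h2
        omega
  have hdown : ∀ N : ℕ, ∀ s : ℤ, c - N ≤ s → s < c + P.k → (↑(Yu P ^ s) : Alg P) ∈ S := by
    intro N
    induction N with
    | zero => intro s h1 h2; exact hS s (by simpa using h1) h2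
    | succ N ih =>
      intro s h1 h2
      rcases le_or_gt c s with h | h
      · exact hS s h h2
      push_cast at h1
      obtain ⟨k, hk'⟩ := Nat.exists_eq_add_of_le' hk
      have h3 := hrec s
      rw [hk', Finset.sum_range_succ', hq0, Nat.cast_zero, add_zero, ← hk', ← sub_eq_iff_eq_add']
        at h3
      have h4 : (P.q0 : R) • (↑(Yu P ^ s) : Alg P) ∈ S := by
        rw [← h3]
        refine sub_mem (ih _ (by omega) (by omega)) (sum_mem fun i hi => S.smul_mem _ (ih _ ?_ ?_)) <;>
        · have := Finset.mem_range.1 hi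
          push_cast
          omega
      have h5 := S.smul_mem (↑P.q0⁻¹ : R) h4
      rwa [smul_smul, Units.inv_mul, one_smul] at h5
  rcases le_or_gt c d with h | h
  · exact hup (d - c).toNat d h (by omega)
  · exact hdown (c - d).toNat d (by omega) (by omega)

theorem exists_E_one_mul_zpow_mul (hq0 : P.qc 0 = (P.q0 : R)) (hk : 1 ≤ P.k) (hn : 2 ≤ P.n)
    (d : ℤ) : ∃ c : R, Eg P 1 * ↑(Yu P ^ d) * Eg P 1 = c • Eg P 1 := by
  have h : Submodule.span R ((fun s : ℤ => (↑(Yu P ^ s) : Alg P)) '' Set.Ico 0 (0 + (P.k : ℤ))) ≤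
      (Submodule.span R {Eg P 1}).comap (LinearMap.mulLeftRight R (Eg P 1, Eg P 1)) := by
    rw [Submodule.span_le]
    rintro _ ⟨s, ⟨h1, h2⟩, rfl⟩
    obtain ⟨m, rfl⟩ := Int.eq_ofNat_of_zero_le h1
    rw [SetLike.mem_coe, Submodule.mem_comap, LinearMap.mulLeftRight_apply, Submodule.mem_span_singleton]
    refine ⟨P.A m, ?_⟩
    dsimp only
    rw [zpow_natCast, Units.val_pow_eq_pow_val, val_Yu, EYE P hn (by omega)]
  have := h (Yu_zpow_mem_span P hq0 hk 0 d)
  rw [Submodule.mem_comap, LinearMap.mulLeftRight_apply, Submodule.mem_span_singleton] at this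
  obtain ⟨c, hc⟩ := this
  exact ⟨c, hc.symm⟩

/-- The elements of `B_{t-1}` commuting with all `X_s` and `e_s` with `s ≥ t`. -/
def BsubCentral (t : ℕ) : Subalgebra R (Alg P) :=
  Bsub P (t - 1) ⊓ Subalgebra.centralizer R {x | ∃ s, t ≤ s ∧ (x = Xg P s ∨ x = Eg P s)}

theorem mem_BsubCentral {t : ℕ} {z : Alg P} : z ∈ BsubCentral P t ↔ z ∈ Bsub P (t - 1) ∧
    ∀ s, t ≤ s → Commute (Xg P s) z ∧ Commute (Eg P s) z := by
  rw [BsubCentral, Algebra.mem_inf, Subalgebra.mem_centralizer_iff]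
  refine and_congr_right fun _ => ⟨fun h s hs => ⟨h _ ⟨s, hs, Or.inl rfl⟩, h _ ⟨s, hs, Or.inr rfl⟩⟩,
    ?_⟩
  rintro h _ ⟨s, hs, rfl | rfl⟩
  · exact (h s hs).1
  · exact (h s hs).2

theorem BsubCentral_succ (t : ℕ) : BsubCentral P t ≤ BsubCentral P (t + 1) := fun z hz => by
  rw [mem_BsubCentral] at hz ⊢
  exact ⟨Bsub_mono P (by omega) hz.1, fun s hs => hz.2 s (by omega)⟩

theorem Ju_zpow_mem_BsubCentral {t : ℕ} (ht : 1 ≤ t) (d : ℤ) :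
    (↑(Ju P t ^ d) : Alg P) ∈ BsubCentral P (t + 1) := by
  rw [mem_BsubCentral]
  exact ⟨Ju_zpow_mem_Bsub P (by omega) d, fun s hs =>
    ⟨commute_Ju_zpow P (commute_Xg_Ju_of_lt P ht hs) d,
      commute_Ju_zpow P (commute_Eg_Ju_of_lt P ht hs) d⟩⟩

theorem exists_Eg_mul_zpow_mul (hq0 : P.qc 0 = (P.q0 : R)) (hk : 1 ≤ P.k) {t : ℕ} (ht : 1 ≤ t)
    (hn : t ≤ P.n - 1) (d : ℤ) :
    ∃ z ∈ BsubCentral P t, Eg P t * ↑(Ju P t ^ d) * Eg P t = Eg P t * z := by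
  induction t, ht using Nat.le_induction generalizing d with
  | base =>
    obtain ⟨c, hc⟩ := exists_E_one_mul_zpow_mul P hq0 hk (by omega) d
    refine ⟨algebraMap R _ c, Subalgebra.algebraMap_mem _ c, ?_⟩
    rw [Ju_one, hc, Algebra.smul_def, Algebra.commutes]
  | succ t ht ih =>
    let N : Submodule R (Alg P) :=
      (Subalgebra.toSubmodule (BsubCentral P (t + 1))).map (LinearMap.mulLeft R (Eg P (t + 1)))
    have hN : ∀ w, w ∈ N ↔ ∃ z ∈ BsubCentral P (t + 1), Eg P (t + 1) * z = w := fun w => by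
      simp [N]
    have hNr : ∀ w ∈ N, ∀ z ∈ BsubCentral P (t + 1), w * z ∈ N := by
      intro w hw z hz
      obtain ⟨z', hz', rfl⟩ := (hN w).1 hw
      exact (hN _).2 ⟨z' * z, mul_mem hz' hz, (mul_assoc _ _ _).symm⟩
    have hn' : t ≤ P.n - 1 := by omega
    have h := (isRankTwo P ht hn').mul_b_zpow_mul_mem (N := N) (f := Eg P (t + 1))
      (y := Xu P (t + 1)) ?_ ?_ ?_ ?_ (EEE_down P ht hn)
      (Xg_mul_Eg P (by omega) hn) ?_ ?_ ?_ ?_ ?_ d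
    · obtain ⟨z, hz, hz'⟩ := (hN _).1 h
      exact ⟨z, hz, hz'.symm⟩
    · rw [Units.eq_mul_inv_iff_mul_eq]
      exact EXX_up P ht hn
    · rw [mul_assoc]
      exact (Xg_mul_Eg_mul_Eg P ht hn).symm
    · rw [Units.mul_inv_eq_iff_eq_mul, val_Xu, val_Xu, mul_assoc, mul_assoc,
        ← mul_assoc (Eg P t), EXX_down P ht hn, ← mul_assoc, EEE_down P ht hn]
    · rw [mul_assoc]
      exact (Xgi_mul_Eg_mul_Eg P ht hn).symm
    · exact commute_Xg_Ju_of_lt P ht (by omega)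
    · exact (commute_Eg_Ju_of_lt P ht (by omega)).symm
    · exact (hN _).2 ⟨1, one_mem _, mul_one _⟩
    · exact fun w hw d => hNr w hw _ (Ju_zpow_mem_BsubCentral P ht d)
    · intro d
      obtain ⟨z, hz, hz'⟩ := ih hn' d
      exact ⟨z, hz', ((mem_BsubCentral P).1 hz |>.2 _ (by omega)).2,
        fun w hw => hNr w hw z (BsubCentral_succ P t hz)⟩

end CBMW

theorem mul_mem_span_of_forall_mul_mem {R A : Type*} [CommRing R] [Ring A] [Algebra R A]
    {S : Set A} {w b : A} (h : ∀ x ∈ S, x * b ∈ Submodule.span R S)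
    (hw : w ∈ Submodule.span R S) : w * b ∈ Submodule.span R S := by
  have : Submodule.span R S ≤ (Submodule.span R S).comap (LinearMap.mulRight R b) :=
    Submodule.span_le.2 h
  exact this hw

namespace CBMW

variable {R : Type} [CommRing R] (P : Params R)

/-- The span of the `α_{ijl}^p b` with `1 ≤ i ≤ j ≤ l`, `b ∈ B_{l-1}` and `(i, p)` subject to
the condition `C`. -/
def arcSpan (l : ℕ) (C : ℕ → ℤ → Prop) : Submodule R (Alg P) :=
  Submodule.span R {x | ∃ (i j : ℕ) (p : ℤ) (b : Alg P), 1 ≤ i ∧ i ≤ j ∧ j ≤ l ∧ C i p ∧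
    b ∈ Bsub P (l - 1) ∧ x = ↑(Ju P i ^ p) * arc P i j (l + 1) * b}

variable {P} {l : ℕ} {C C₁ C₂ : ℕ → ℤ → Prop}

theorem arcSpan_mono (h : ∀ i p, 1 ≤ i → i ≤ l → C₁ i p → C₂ i p) :
    arcSpan P l C₁ ≤ arcSpan P l C₂ := by
  refine Submodule.span_mono ?_
  rintro x ⟨i, j, p, b, h1, h2, h3, h4, h5⟩
  exact ⟨i, j, p, b, h1, h2, h3, h i p h1 (by omega) h4, h5⟩

theorem zpow_mul_arc_mul_mem {i j : ℕ} {p : ℤ} {b : Alg P} (hi : 1 ≤ i) (hij : i ≤ j) (hj : j ≤ l)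
    (hC : C i p) (hb : b ∈ Bsub P (l - 1)) :
    ↑(Ju P i ^ p) * arc P i j (l + 1) * b ∈ arcSpan P l C :=
  Submodule.subset_span ⟨i, j, p, b, hi, hij, hj, hC, hb, rfl⟩

theorem zpow_mul_arc_mem {i j : ℕ} {p : ℤ} (hi : 1 ≤ i) (hij : i ≤ j) (hj : j ≤ l)
    (hC : C i p) : ↑(Ju P i ^ p) * arc P i j (l + 1) ∈ arcSpan P l C := by
  simpa using zpow_mul_arc_mul_mem hi hij hj hC (one_mem (Bsub P (l - 1)))

theorem mul_mem_arcSpan {w b : Alg P} (hw : w ∈ arcSpan P l C) (hb : b ∈ Bsub P (l - 1)) :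
    w * b ∈ arcSpan P l C := by
  refine mul_mem_span_of_forall_mul_mem ?_ hw
  rintro _ ⟨i, j, p, b', h1, h2, h3, h4, h5, rfl⟩
  rw [mul_assoc]
  exact zpow_mul_arc_mul_mem h1 h2 h3 h4 (mul_mem h5 hb)

theorem mul_mem_of_arcSpan {c w : Alg P} {N : Submodule R (Alg P)}
    (hN : ∀ w ∈ N, ∀ b ∈ Bsub P (l - 1), w * b ∈ N)
    (h : ∀ i j p, 1 ≤ i → i ≤ j → j ≤ l → C i p → c * (↑(Ju P i ^ p) * arc P i j (l + 1)) ∈ N)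
    (hw : w ∈ arcSpan P l C) : c * w ∈ N := by
  have : arcSpan P l C ≤ N.comap (LinearMap.mulLeft R c) := by
    refine Submodule.span_le.2 ?_
    rintro _ ⟨i, j, p, b', h1, h2, h3, h4, h5, rfl⟩
    rw [SetLike.mem_coe, Submodule.mem_comap, LinearMap.mulLeft_apply, ← mul_assoc]
    exact hN _ (h i j p h1 h2 h3 h4) _ h5
  exact this hw

theorem seg_Xg_mem_Bsub {i j m : ℕ} (h : j ≤ m) : seg (Xg P) i j ∈ Bsub P m :=
  seg_mem _ (S := (Bsub P m).toSubmonoid) fun t _ ht => Xg_mem_Bsub P (by omega)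

theorem Eg_mul_arc_eq {t j : ℕ} (ht : 1 ≤ t) (htj : t < j) (hjl : j ≤ l) (hn : l ≤ P.n - 1) :
    ∃ y ∈ Bsub P (l - 1), Eg P t * arc P (t + 1) j (l + 1) = arc P t t (l + 1) * y := by
  obtain ⟨y, hy, h⟩ := Eg_mul_arc P ht htj hjl hn
  refine ⟨y, ?_, by rw [h, arc, seg_self, one_mul]⟩
  have : Submonoid.closure {x | ∃ s, t ≤ s ∧ s + 2 ≤ l ∧ x = Xgi P s}
      ≤ (Bsub P (l - 1)).toSubmonoid := by
    rw [Submonoid.closure_le]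
    rintro _ ⟨s, _, h2, rfl⟩
    exact Xgi_mem_Bsub P (by omega)
  exact this hy

theorem Xg_mul_arc {i j m : ℕ} (h : i < j) : Xg P i * arc P (i + 1) j m = arc P i j m := by
  rw [arc, arc, seg_cons _ h, mul_assoc]

theorem arc_mul_Eg_seg {i m : ℕ} (h : i < m) : Eg P i * seg (Eg P) (i + 1) m = arc P i i m := by
  rw [arc, seg_self, one_mul, seg_cons _ h]

theorem exists_Eg_mul_zpow_mul_Eg_mul (hq0 : P.qc 0 = (P.q0 : R)) (hk : 1 ≤ P.k) {t : ℕ}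
    (ht : 1 ≤ t) (htl : t ≤ l) (hn : t ≤ P.n - 1) {v : Alg P}
    (hv : ∀ z, (∀ s, t ≤ s → Commute (Xg P s) z ∧ Commute (Eg P s) z) → Commute v z) (d : ℤ) :
    ∃ z, Eg P t * (↑(Ju P t ^ d) * (Eg P t * v)) = Eg P t * v * z ∧
      ∀ w ∈ arcSpan P l C, w * z ∈ arcSpan P l C := by
  obtain ⟨z, hz, h⟩ := exists_Eg_mul_zpow_mul P hq0 hk ht hn d
  rw [mem_BsubCentral] at hz
  refine ⟨z, ?_, fun w hw => mul_mem_arcSpan hw (Bsub_mono P (by omega) hz.1)⟩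
  rw [mul_assoc, (hv z hz.2).eq, ← mul_assoc, ← mul_assoc, ← mul_assoc, h]

/-- Left multiplication by `X_t` and `e_t` with `t` larger than the first index. -/
theorem mul_arc_mem_of_lt {K : Submodule R (Alg P)} {t i j : ℕ} (hi : 1 ≤ i) (hij : i ≤ j)
    (hj : j ≤ l) (hit : i < t) (htl : t ≤ l) (hn : l ≤ P.n - 1)
    (hK : ∀ j' b, i ≤ j' → j' ≤ l → b ∈ Bsub P (l - 1) → arc P i j' (l + 1) * b ∈ K)
    (hK' : ∀ b, b ∈ Bsub P (l - 1) → arc P t t (l + 1) * b ∈ K) :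
    Xg P t * arc P i j (l + 1) ∈ K ∧ Eg P t * arc P i j (l + 1) ∈ K := by
  have hK1 : ∀ j', i ≤ j' → j' ≤ l → arc P i j' (l + 1) ∈ K := fun j' h1 h2 => by
    simpa using hK j' 1 h1 h2 (one_mem _)
  obtain ⟨t, rfl⟩ := Nat.exists_eq_add_of_le' (show 1 ≤ t by omega)
  rcases lt_trichotomy (t + 1) j with h | rfl | h
  · have c1 := (semiconjBy_pX_Xg P hi (show i ≤ t by omega) (show t + 2 ≤ j by omega)
      (by omega)).eq
    have c2 := (semiconjBy_pX_Eg P hi (show i ≤ t by omega) (show t + 2 ≤ j by omega)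
      (by omega)).eq
    have d1 : Commute (Xg P t) (seg (Eg P) j (l + 1)) :=
      commute_seg _ fun s _ _ => commute_Xg_Eg P (by omega)
    have d2 : Commute (Eg P t) (seg (Eg P) j (l + 1)) :=
      commute_seg _ fun s _ _ => commute_Eg_Eg P (by omega)
    rw [arc, ← mul_assoc, ← mul_assoc, ← c1, ← c2, mul_assoc, mul_assoc, d1.eq, d2.eq, ← mul_assoc,
      ← mul_assoc]
    exact ⟨hK j _ hij hj (Xg_mem_Bsub P (by omega)), hK j _ hij hj (Eg_mem_Bsub P (by omega))⟩
  · have hit' : i ≤ t := by omega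
    have e1 : arc P i (t + 1) (l + 1)
        = seg (Xg P) i t * (Xg P t * (Eg P (t + 1) * seg (Eg P) (t + 2) (l + 1))) := by
      rw [arc, seg_snoc _ hit', seg_cons (Eg P) (show t + 1 < l + 1 by omega), mul_assoc]
    have c1 : Commute (Xg P (t + 1)) (seg (Xg P) i t) :=
      commute_seg _ fun s _ _ => commute_Xg_Xg P (by omega)
    have c2 : Commute (Eg P (t + 1)) (seg (Xg P) i t) :=
      commute_seg _ fun s _ _ => (commute_Xg_Eg P (by omega)).symm
    rw [e1, ← mul_assoc (Xg P (t + 1)), ← mul_assoc (Eg P (t + 1)), c1.eq, c2.eq]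
    constructor
    · have e2 : seg (Xg P) i t * Xg P (t + 1) *
          (Xg P t * (Eg P (t + 1) * seg (Eg P) (t + 2) (l + 1))) = arc P i t (l + 1) := by
        rw [arc, seg_cons (Eg P) (show t < l + 1 by omega),
          seg_cons (Eg P) (show t + 1 < l + 1 by omega), ← mul_assoc (Eg P t),
          ← XXE_down P (by omega) (by omega)]
        simp only [mul_assoc]
      rw [e2]
      exact hK1 t hit' (by omega)
    · have e3 : Eg P (t + 1) * Xg P t * Eg P (t + 1) = ((P.lam⁻¹ : Rˣ) : R) • Eg P (t + 1) := by
        have h1 : Eg P (t + 1) * Xg P t = Eg P (t + 1) * Eg P t * Xgi P (t + 1) := by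
          rw [← val_inv_Xu, Units.eq_mul_inv_iff_mul_eq]
          exact EXX_up P (by omega) (by omega)
        have h2 := (isRankTwo P (show 1 ≤ t + 1 by omega) (by omega)).xinv_mul_e
        rw [val_inv_Xu] at h2
        rw [h1, mul_assoc, h2, mul_smul_comm, EEE_down P (by omega) (by omega)]
      have e2 : seg (Xg P) i t * Eg P (t + 1) *
          (Xg P t * (Eg P (t + 1) * seg (Eg P) (t + 2) (l + 1)))
          = ((P.lam⁻¹ : Rˣ) : R) • (arc P (t + 1) (t + 1) (l + 1) * seg (Xg P) i t) := by
        rw [arc, seg_self, one_mul, ← (commute_pX_pE P (by omega)).eq,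
          seg_cons (Eg P) (show t + 1 < l + 1 by omega), ← mul_smul_comm, ← smul_mul_assoc, ← e3]
        simp only [mul_assoc]
      rw [e2]
      exact K.smul_mem _ (hK' _ (seg_Xg_mem_Bsub (by omega)))
  · rcases (show t = j ∨ j + 1 ≤ t by omega) with rfl | h'
    · have c1 : Commute (Xg P (t + 1)) (seg (Xg P) i t) :=
        commute_seg _ fun s _ _ => commute_Xg_Xg P (by omega)
      have c2 : Commute (Eg P (t + 1)) (seg (Xg P) i t) :=
        commute_seg _ fun s _ _ => (commute_Xg_Eg P (by omega)).symm
      have e1 : arc P i t (l + 1)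
          = seg (Xg P) i t * (Eg P t * (Eg P (t + 1) * seg (Eg P) (t + 2) (l + 1))) := by
        rw [arc, seg_cons (Eg P) (show t < l + 1 by omega),
          seg_cons (Eg P) (show t + 1 < l + 1 by omega)]
      have e2 : seg (Xg P) i t * seg (Eg P) (t + 1) (l + 1)
          = arc P (t + 1) (t + 1) (l + 1) * seg (Xg P) i t := by
        rw [arc, seg_self, one_mul, (commute_pX_pE P (by omega)).eq]
      have e3 : seg (Xg P) i t * seg (Eg P) (t + 1) (l + 1) ∈ K := by
        rw [e2]
        exact hK' _ (seg_Xg_mem_Bsub (by omega))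
      constructor
      · have e4 : Xg P (t + 1) * arc P i t (l + 1)
            = seg (Xg P) i t * Xgi P t * seg (Eg P) (t + 1) (l + 1) := by
          rw [e1, ← mul_assoc, c1.eq, mul_assoc, ← mul_assoc (Eg P t), ← mul_assoc (Xg P (t + 1)),
            Xg_mul_Eg_mul_Eg P (by omega) (by omega),
            seg_cons (Eg P) (show t + 1 < l + 1 by omega)]
          simp only [mul_assoc]
        rw [e4]
        refine (isRankTwo P (show 1 ≤ t by omega) (by omega)).mul_xinv_mem K ?_ e3 ?_
        · have := hK1 (t + 1) (by omega) (by omega)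
          rwa [arc, seg_snoc _ hij] at this
        · have := hK1 t hij hj
          rwa [arc, seg_cons (Eg P) (show t < l + 1 by omega), ← mul_assoc] at this
      · have e4 : Eg P (t + 1) * arc P i t (l + 1)
            = seg (Xg P) i t * seg (Eg P) (t + 1) (l + 1) := by
          rw [e1, ← mul_assoc, c2.eq, mul_assoc, ← mul_assoc (Eg P t), ← mul_assoc (Eg P (t + 1)),
            ← mul_assoc (Eg P (t + 1)), EEE_down P (by omega) (by omega),
            seg_cons (Eg P) (show t + 1 < l + 1 by omega)]
        rwa [e4]
    · obtain ⟨t, rfl⟩ := Nat.exists_eq_add_of_le' (show 1 ≤ t by omega)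
      have c1 : Commute (Xg P (t + 2)) (seg (Xg P) i j) :=
        commute_seg _ fun s _ _ => commute_Xg_Xg P (by omega)
      have c2 : Commute (Eg P (t + 2)) (seg (Xg P) i j) :=
        commute_seg _ fun s _ _ => (commute_Xg_Eg P (by omega)).symm
      have d1 := (semiconjBy_pE_Xg P (show 1 ≤ j by omega) (show j ≤ t by omega)
        (show t + 3 ≤ l + 1 by omega) (by omega)).eq
      have d2 := (semiconjBy_pE_Eg P (show 1 ≤ j by omega) (show j ≤ t by omega)
        (show t + 3 ≤ l + 1 by omega) (by omega)).eq
      rw [add_assoc, arc, ← mul_assoc, ← mul_assoc, c1.eq, c2.eq, mul_assoc, mul_assoc, ← d1, ← d2,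
        ← mul_assoc, ← mul_assoc]
      exact ⟨hK j _ hij hj (Xg_mem_Bsub P (by omega)), hK j _ hij hj (Eg_mem_Bsub P (by omega))⟩

/-- `X_t`, `X_t⁻¹` and `e_t` map `arcSpan P l C₁` into `arcSpan P l C₂` when `C₂` is large enough
compared to `C₁`. -/
theorem mul_mem_arcSpan_of (hq0 : P.qc 0 = (P.q0 : R)) (hk : 1 ≤ P.k) {t : ℕ} (ht : 1 ≤ t)
    (htl : t ≤ l) (hn : l ≤ P.n - 1) (hC : ∀ i p, C₁ i p → C₂ i p)
    (hb : ∀ p s, C₁ (t + 1) p → IsBetweenZero p s → C₂ t s ∧ C₂ (t + 1) s)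
    (ha : ∀ p s, C₁ t p → |s| ≤ |p| → C₂ t s)
    (ha' : ∀ p s, C₁ t p → IsBetweenZero p s → C₂ (t + 1) s)
    (hlt : ∀ i p, i < t → C₁ i p → C₂ t 0) {w : Alg P} (hw : w ∈ arcSpan P l C₁) :
    Xg P t * w ∈ arcSpan P l C₂ ∧ Xgi P t * w ∈ arcSpan P l C₂ ∧ Eg P t * w ∈ arcSpan P l C₂ := by
  have H := isRankTwo P ht (htl.trans hn)
  have hR : ∀ w ∈ arcSpan P l C₂, ∀ b ∈ Bsub P (l - 1), w * b ∈ arcSpan P l C₂ :=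
    fun w hw b hb => mul_mem_arcSpan hw hb
  have key : ∀ i j p, 1 ≤ i → i ≤ j → j ≤ l → C₁ i p →
      Xg P t * (↑(Ju P i ^ p) * arc P i j (l + 1)) ∈ arcSpan P l C₂ ∧
      Xgi P t * (↑(Ju P i ^ p) * arc P i j (l + 1)) ∈ arcSpan P l C₂ ∧
      Eg P t * (↑(Ju P i ^ p) * arc P i j (l + 1)) ∈ arcSpan P l C₂ := by
    intro i j p hi hij hj hp
    have hRJ : t < j → ∀ w ∈ arcSpan P l C₂, ∀ d : ℤ, w * ↑(Ju P t ^ d) ∈ arcSpan P l C₂ :=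
      fun h w hw d => hR w hw _ (Ju_zpow_mem_Bsub P (by omega) d)
    have hv : t < j → Commute (↑(Ju P t)) (arc P (t + 1) j (l + 1)) := fun h =>
      (commute_arc_of_mem_Bsub P (Ju_mem_Bsub_and P t).1 (by omega) (by omega) le_rfl).symm
    have hev : t < j → ∀ s, C₂ t s →
        ↑(Ju P t ^ s) * (Eg P t * arc P (t + 1) j (l + 1)) ∈ arcSpan P l C₂ := by
      intro h s hs
      obtain ⟨y, hy, h1⟩ := Eg_mul_arc_eq ht h hj hn
      rw [h1, ← mul_assoc]
      exact zpow_mul_arc_mul_mem ht le_rfl htl hs hy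
    have hxv : t < j → ∀ s, C₂ t s →
        ↑(Ju P t ^ s) * (Xg P t * arc P (t + 1) j (l + 1)) ∈ arcSpan P l C₂ := by
      intro h s hs
      rw [Xg_mul_arc h]
      exact zpow_mul_arc_mem ht h.le hj hs
    rcases lt_trichotomy i t with h | rfl | h
    · let K := (arcSpan P l C₂).comap (LinearMap.mulLeft R (↑(Ju P i ^ p) : Alg P))
      have hK : ∀ w, w ∈ K ↔ ↑(Ju P i ^ p) * w ∈ arcSpan P l C₂ := fun w => Iff.rfl
      have h1 := mul_arc_mem_of_lt (K := K) hi hij hj h htl hn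
        (fun j' b h1 h2 h3 => by
          rw [hK, ← mul_assoc]
          exact zpow_mul_arc_mul_mem hi h1 h2 (hC _ _ hp) h3)
        (fun b h1 => by
          have h2 := commute_arc_of_mem_Bsub P (l := l + 1) (Ju_zpow_mem_Bsub P (le_refl i) p)
            (show 2 ≤ t by omega) le_rfl h
          rw [hK, ← mul_assoc, ← h2.eq, mul_assoc]
          simpa using zpow_mul_arc_mul_mem (l := l) (C := C₂) (p := 0) ht le_rfl htl
            (hlt i p h hp) (mul_mem (Ju_zpow_mem_Bsub P (by omega) p) h1))
      have h2 := H.mul_xinv_mem K (u := 1) (v := arc P i j (l + 1)) (by simpa using h1.1)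
        (by
          rw [hK, one_mul]
          exact zpow_mul_arc_mem hi hij hj (hC _ _ hp)) (by simpa using h1.2)
      rw [one_mul, val_inv_Xu] at h2
      have c1 := commute_Ju_zpow P (commute_Xg_Ju_of_lt P hi h) p
      have c2 := commute_Ju_zpow P (commute_Eg_Ju_of_lt P hi h) p
      have c3 := (commute_Xgi P c1.symm).symm
      rw [← mul_assoc, ← mul_assoc, ← mul_assoc, c1.eq, c2.eq, c3.eq, mul_assoc, mul_assoc,
        mul_assoc]
      exact ⟨h1.1, h2, h1.2⟩
    · rcases hij.eq_or_lt with rfl | hij'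
      · rw [← arc_mul_Eg_seg (show i < l + 1 by omega)]
        refine H.smul_a_zpow_e_mem (fun d => exists_Eg_mul_zpow_mul_Eg_mul hq0 hk ht htl (by omega)
          (fun z hz => ?_) d) p (fun s hs => ?_)
        · exact (commute_seg _ fun s h1 _ => (hz s (by omega)).2.symm).symm
        · rw [arc_mul_Eg_seg (show i < l + 1 by omega)]
          exact zpow_mul_arc_mem ht le_rfl htl (ha p s hp hs)
      · rw [← Xg_mul_arc hij']
        refine H.smul_a_zpow_x_mem (hv hij') (hRJ hij')
          (fun d => exists_Eg_mul_zpow_mul_Eg_mul hq0 hk ht htl (by omega) (fun z hz => ?_) d) p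
          (fun s hs => hev hij' s (ha p s hp hs)) (fun s hs => hxv hij' s (ha p s hp hs))
          (fun s hs => zpow_mul_arc_mem (by omega) hij' hj (ha' p s hp hs))
        exact (commute_seg _ fun s h1 _ => (hz s (by omega)).1.symm).symm.mul_left
          (commute_seg _ fun s h1 _ => (hz s (by omega)).2.symm).symm
    · rcases (show i = t + 1 ∨ t + 2 ≤ i by omega) with rfl | h'
      · exact H.smul_b_zpow_mem (hv hij) (hRJ hij) p (fun s hs => hxv hij s (hb p s hp hs).1)
          (fun s hs => hev hij s (hb p s hp hs).1)
          (fun s hs => zpow_mul_arc_mem hi hij hj (hb p s hp hs).2)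
      · have h1 : ∀ c ∈ Bsub P (t + 1),
            c * (↑(Ju P i ^ p) * arc P i j (l + 1)) ∈ arcSpan P l C₂ := by
          intro c hc
          rw [← mul_assoc, ← (commute_Ju_zpow_of_mem_Bsub P hc h' (by omega) p).eq, mul_assoc,
            ← (commute_arc_of_mem_Bsub P hc (by omega) hij h').eq, ← mul_assoc]
          exact zpow_mul_arc_mul_mem hi hij hj (hC _ _ hp) (Bsub_mono P (by omega) hc)
        exact ⟨h1 _ (Xg_mem_Bsub P le_rfl), h1 _ (Xgi_mem_Bsub P le_rfl),
          h1 _ (Eg_mem_Bsub P le_rfl)⟩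
  exact ⟨mul_mem_of_arcSpan hR (fun i j p h1 h2 h3 h4 => (key i j p h1 h2 h3 h4).1) hw,
    mul_mem_of_arcSpan hR (fun i j p h1 h2 h3 h4 => (key i j p h1 h2 h3 h4).2.1) hw,
    mul_mem_of_arcSpan hR (fun i j p h1 h2 h3 h4 => (key i j p h1 h2 h3 h4).2.2) hw⟩

end CBMW

theorem IsRankTwo.b_pow_mul_mem {R A : Type*} [CommRing R] [Ring A] [Algebra R A] {δ : R}
    {lam : Rˣ} {x a b : Aˣ} {e v : A} {N : Submodule R A} (H : IsRankTwo δ lam x a b e)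
    (hv : Commute (a : A) v) (hR : ∀ w ∈ N, ∀ d : ℤ, w * ↑(a ^ d) ∈ N)
    (hx : ∀ w ∈ N, x * w ∈ N) (h1 : ∀ s : ℤ, ↑(a ^ s) * (↑x⁻¹ * v) ∈ N)
    (h2 : ∀ s : ℤ, ↑(a ^ s) * (e * v) ∈ N) (h3 : v ∈ N) (p : ℕ) : ↑(b ^ p) * v ∈ N := by
  have va : ∀ d : ℤ, ↑(a ^ d) * v = v * ↑(a ^ d) := fun d => (hv.units_zpow_left d).eq
  induction p using Nat.strong_induction_on with
  | _ p ih =>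
  rcases Nat.eq_zero_or_pos p with rfl | hp
  · simpa using h3
  rw [← Units.mul_inv_cancel_left x (↑(b ^ p) * v)]
  refine hx _ ?_
  have := H.xinv_mul_b_pow_mem N (u := 1) (v := v) (p := p) ?_ ?_ ?_
  · simpa only [one_mul, mul_assoc] using this
  · simpa only [one_mul, mul_assoc, zpow_natCast] using h1 p
  · intro s q hs hq
    rw [one_mul, ← zpow_natCast, ← zpow_natCast, H.comm_zpow, mul_assoc, va, ← mul_assoc,
      zpow_natCast b]
    exact hR _ (ih q (by omega)) _
  · intro s q hs hq
    rw [one_mul, mul_assoc _ e, ← zpow_natCast, ← zpow_natCast, H.e_mul_b_zpow, ← mul_assoc,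
      mul_assoc, va, ← mul_assoc, mul_assoc _ e]
    exact hR _ (h2 s) _

theorem IsRankTwo.b_zpow_mul_mem {R A : Type*} [CommRing R] [Ring A] [Algebra R A] {δ : R}
    {lam : Rˣ} {x a b : Aˣ} {e v : A} {N : Submodule R A} (H : IsRankTwo δ lam x a b e)
    (hv : Commute (a : A) v) (hR : ∀ w ∈ N, ∀ d : ℤ, w * ↑(a ^ d) ∈ N)
    (hx : ∀ w ∈ N, x * w ∈ N) (hx' : ∀ w ∈ N, ↑x⁻¹ * w ∈ N)
    (h1 : ∀ s : ℤ, ↑(a ^ s) * (x * v) ∈ N)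
    (h2 : ∀ s : ℤ, ↑(a ^ s) * (e * v) ∈ N) (h3 : v ∈ N) (p : ℤ) : ↑(b ^ p) * v ∈ N := by
  obtain ⟨m, rfl | rfl⟩ := p.eq_nat_or_neg
  · rw [zpow_natCast]
    refine H.b_pow_mul_mem hv hR hx (fun s => ?_) h2 h3 m
    rw [← mul_assoc]
    refine H.mul_xinv_mem N (by rw [mul_assoc]; exact h1 s) ?_ (by rw [mul_assoc]; exact h2 s)
    rw [(hv.units_zpow_left s).eq]
    exact hR _ h3 _
  · have := H.inv.b_pow_mul_mem (N := N) (v := v) hv.units_inv_left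
      (fun w hw d => by rw [inv_zpow']; exact hR w hw _) hx'
      (fun s => by rw [inv_inv, inv_zpow']; exact h1 _)
      (fun s => by rw [inv_zpow']; exact h2 _) h3 m
    rwa [show (b⁻¹) ^ m = b ^ (-(m : ℤ)) by rw [zpow_neg, inv_pow, zpow_natCast]] at this

namespace CBMW

variable {R : Type} [CommRing R] {P : Params R} {l : ℕ}

theorem zero_mem_Pset {k : ℕ} (hk : 1 ≤ k) : (0 : ℤ) ∈ Pset k := ⟨by omega, by omega⟩

theorem mem_Pset_of_isBetweenZero {k : ℕ} {p s : ℤ} (hp : p ∈ Pset k)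
    (hs : IsBetweenZero p s) : s ∈ Pset k := by
  obtain ⟨h1, h2⟩ := hp
  rcases hs with hs | hs <;> exact ⟨by omega, by omega⟩

theorem zpow_mul_arc_mem_Pset (hq0 : P.qc 0 = (P.q0 : R)) (hk : 1 ≤ P.k) (hn : l ≤ P.n - 1)
    {i j : ℕ} (hi : 1 ≤ i) (hij : i ≤ j) (hj : j ≤ l) (d : ℤ) :
    ↑(Ju P i ^ d) * arc P i j (l + 1) ∈ arcSpan P l fun _ p => p ∈ Pset P.k := by
  induction i using Nat.strong_induction_on generalizing j d with
  | _ i ih =>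
  set N := arcSpan P l fun _ p => p ∈ Pset P.k
  obtain ⟨t, rfl⟩ := Nat.exists_eq_add_of_le' hi
  rcases Nat.eq_zero_or_pos t with rfl | ht
  · have h := Yu_zpow_mem_span P hq0 hk ((↑(P.k / 2) : ℤ) - ((P.k : ℤ) - 1)) d
    rw [← Ju_one] at h
    have h' : ↑(Ju P 1 ^ d) ∈ N.comap (LinearMap.mulRight R (arc P 1 j (l + 1))) := by
      refine (Submodule.span_le.2 ?_) h
      rintro _ ⟨s, ⟨h1, h2⟩, rfl⟩
      exact zpow_mul_arc_mem (l := l) hi hij hj ⟨h1, by omega⟩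
    exact h'
  · have hN : arcSpan P l (fun i p => i ≤ t ∨ p ∈ Pset P.k) ≤ N := by
      refine Submodule.span_le.2 ?_
      rintro _ ⟨i, j, p, b, h1, h2, h3, h4 | h4, h5, rfl⟩
      · exact mul_mem_arcSpan (ih i (by omega) h1 h2 h3 p) h5
      · exact mul_mem_arcSpan (zpow_mul_arc_mem h1 h2 h3 h4) h5
    have hst : ∀ w ∈ N, _ := fun w hw => mul_mem_arcSpan_of (l := l)
      (C₁ := fun _ p => p ∈ Pset P.k) (C₂ := fun i p => i ≤ t ∨ p ∈ Pset P.k) hq0 hk ht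
      (by omega) hn
      (fun i p hp => Or.inr hp)
      (fun p s hp hs => ⟨Or.inl le_rfl, Or.inr (mem_Pset_of_isBetweenZero hp hs)⟩)
      (fun p s hp hs => Or.inl le_rfl)
      (fun p s hp hs => Or.inr (mem_Pset_of_isBetweenZero hp hs))
      (fun i p hit hp => Or.inl le_rfl) hw
    refine (isRankTwo P ht (by omega)).b_zpow_mul_mem ?_
      (fun w hw d => mul_mem_arcSpan hw (Ju_zpow_mem_Bsub P (by omega) d))
      (fun w hw => hN (hst w hw).1) (fun w hw => hN (hst w hw).2.1) (fun s => ?_) (fun s => ?_) ?_ d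
    · exact (commute_arc_of_mem_Bsub P (Ju_mem_Bsub_and P t).1 (by omega) (by omega) le_rfl).symm
    · rw [val_Xu, Xg_mul_arc (by omega)]
      exact ih t (by omega) ht (by omega) hj s
    · obtain ⟨y, hy, h⟩ := Eg_mul_arc_eq ht (show t < j by omega) hj hn
      rw [h, ← mul_assoc]
      exact mul_mem_arcSpan (ih t (by omega) ht le_rfl (by omega) s) hy
    · simpa using zpow_mul_arc_mem (p := 0) hi hij hj
        (C := fun _ p => p ∈ Pset P.k) (zero_mem_Pset hk)

theorem mul_mem_arcSpan_Pset (hq0 : P.qc 0 = (P.q0 : R)) (hk : 1 ≤ P.k) (hn : l ≤ P.n - 1)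
    {c w : Alg P} (hc : c ∈ Bsub P (l + 1)) (hw : w ∈ arcSpan P l fun _ p => p ∈ Pset P.k) :
    c * w ∈ arcSpan P l fun _ p => p ∈ Pset P.k := by
  have hN : (arcSpan P l fun _ p => p ∈ Pset P.k) = arcSpan P l fun _ _ => True := by
    refine le_antisymm (arcSpan_mono fun _ _ _ _ _ => trivial) (Submodule.span_le.2 ?_)
    rintro _ ⟨i, j, p, b, h1, h2, h3, h4, h5, rfl⟩
    exact mul_mem_arcSpan (zpow_mul_arc_mem_Pset hq0 hk hn h1 h2 h3 p) h5
  rw [hN] at hw ⊢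
  have hst : ∀ t, 1 ≤ t → t + 1 ≤ l + 1 → ∀ w ∈ arcSpan P l fun _ _ => True, _ :=
    fun t h1 h2 w hw => mul_mem_arcSpan_of (l := l) (C₁ := fun _ _ => True) (C₂ := fun _ _ => True)
      (t := t) hq0 hk h1 (by omega) hn (fun _ _ _ => trivial) (fun _ _ _ _ => ⟨trivial, trivial⟩)
      (fun _ _ _ _ => trivial) (fun _ _ _ _ => trivial) (fun _ _ _ _ => trivial) hw
  have hY : ∀ d : ℤ, ∀ w ∈ arcSpan P l fun _ _ => True,
      ↑(Ju P 1 ^ d) * w ∈ arcSpan P l fun _ _ => True := by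
    intro d w hw
    refine mul_mem_of_arcSpan (fun w hw b hb => mul_mem_arcSpan hw hb) ?_ hw
    intro i j p hi hij hj _
    rcases hi.eq_or_lt with rfl | hi'
    · rw [← mul_assoc, ← Units.val_mul, ← zpow_add]
      exact zpow_mul_arc_mem hi hij hj trivial
    · have h1 := Ju_zpow_mem_Bsub P (le_refl 1) d
      rw [← mul_assoc, ← (commute_Ju_zpow_of_mem_Bsub P h1 hi' (by omega) p).eq, mul_assoc,
        ← (commute_arc_of_mem_Bsub P h1 hi' hij hi').eq, ← mul_assoc]
      exact zpow_mul_arc_mul_mem hi hij hj trivial (Ju_zpow_mem_Bsub P (by omega) d)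
  induction hc using Algebra.adjoin_induction generalizing w with
  | mem x hx =>
    rcases hx with (rfl | rfl) | ⟨s, h1, h2, rfl | rfl | rfl⟩
    · simpa [Ju_one] using hY 1 w hw
    · simpa [Ju_one] using hY (-1) w hw
    · exact (hst s h1 h2 w hw).1
    · exact (hst s h1 h2 w hw).2.1
    · exact (hst s h1 h2 w hw).2.2
  | algebraMap r =>
    rw [← Algebra.smul_def]
    exact Submodule.smul_mem _ _ hw
  | add x y _ _ hx hy =>
    rw [add_mul]
    exact add_mem (hx hw) (hy hw)
  | mul x y _ _ hx hy =>
    rw [mul_assoc]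
    exact hx (hy hw)

end CBMW

/-- The elements of a ring that map a given submodule into itself by left multiplication. -/
def leftStabilizer {R A : Type*} [CommRing R] [Ring A] [Algebra R A] (N : Submodule R A) :
    Submonoid A where
  carrier := {c | ∀ w ∈ N, c * w ∈ N}
  one_mem' w hw := by rwa [one_mul]
  mul_mem' {a b} ha hb w hw := by
    rw [mul_assoc]
    exact ha _ (hb _ hw)

namespace CBMW

variable {R : Type} [CommRing R] {P : Params R} {m i : ℕ}

variable (P) in
/-- The span of the products `α_{i'j',m+2}^p w` with `i' > i`, `p ∈ P` and `w` in the span of the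
`α_{g,h,m}^r b` with `r ∈ P`, `b ∈ B_{m-1}`. -/
def arcPairSpan (m i : ℕ) : Submodule R (Alg P) :=
  Submodule.span R {x | ∃ (i' j' : ℕ) (p : ℤ) (w : Alg P), i < i' ∧ i' ≤ j' ∧ j' ≤ m + 2 ∧
    p ∈ Pset P.k ∧ w ∈ arcSpan P m (fun _ p => p ∈ Pset P.k) ∧
    x = ↑(Ju P i' ^ p) * arc P i' j' (m + 3) * w}

theorem zpow_mul_arc_mul_mem_arcPairSpan {i' j' : ℕ} {p : ℤ} {w : Alg P} (hi : i < i')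
    (hij : i' ≤ j') (hj : j' ≤ m + 2) (hp : p ∈ Pset P.k)
    (hw : w ∈ arcSpan P m fun _ p => p ∈ Pset P.k) :
    ↑(Ju P i' ^ p) * arc P i' j' (m + 3) * w ∈ arcPairSpan P m i :=
  Submodule.subset_span ⟨i', j', p, w, hi, hij, hj, hp, hw, rfl⟩

theorem arcPairSpan_mul_mem {w b : Alg P} (hw : w ∈ arcPairSpan P m i)
    (hb : b ∈ Bsub P (m - 1)) : w * b ∈ arcPairSpan P m i := by
  refine mul_mem_span_of_forall_mul_mem ?_ hw
  rintro _ ⟨i', j', p, w, h1, h2, h3, h4, h5, rfl⟩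
  rw [mul_assoc]
  exact zpow_mul_arc_mul_mem_arcPairSpan h1 h2 h3 h4 (mul_mem_arcSpan h5 hb)

theorem mul_mem_arcPairSpan_of_arcSpan (hq0 : P.qc 0 = (P.q0 : R)) (hk : 1 ≤ P.k)
    (hn : m + 2 ≤ P.n - 1) {x w : Alg P} (hx : x ∈ arcSpan P (m + 2) fun i' p => i < i' ∧ p ∈ Pset P.k)
    (hw : w ∈ arcSpan P m fun _ p => p ∈ Pset P.k) : x * w ∈ arcPairSpan P m i := by
  have : (arcSpan P (m + 2) fun i' p => i < i' ∧ p ∈ Pset P.k) ≤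
      (arcPairSpan P m i).comap (LinearMap.mulRight R w) := by
    refine Submodule.span_le.2 ?_
    rintro _ ⟨i', j', p, b, h1, h2, h3, ⟨h4, h5⟩, h6, rfl⟩
    rw [SetLike.mem_coe, Submodule.mem_comap, LinearMap.mulRight_apply, mul_assoc]
    exact zpow_mul_arc_mul_mem_arcPairSpan h4 h2 h3 h5
      (mul_mem_arcSpan_Pset hq0 hk (by omega) h6 hw)
  exact this hx

theorem mul_mem_arcPairSpan (hq0 : P.qc 0 = (P.q0 : R)) (hk : 1 ≤ P.k)
    (hn : m + 2 ≤ P.n - 1) (hi : 1 ≤ i) (him : i ≤ m + 1) {c w : Alg P} (hc : c ∈ Bsub P i)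
    (hw : w ∈ arcPairSpan P m i) : c * w ∈ arcPairSpan P m i := by
  have : arcPairSpan P m i ≤ (arcPairSpan P m i).comap (LinearMap.mulLeft R c) := by
    refine Submodule.span_le.2 ?_
    rintro _ ⟨i', j', p, w, h1, h2, h3, h4, h5, rfl⟩
    rw [SetLike.mem_coe, Submodule.mem_comap, LinearMap.mulLeft_apply, ← mul_assoc, ← mul_assoc,
      ← (commute_Ju_zpow_of_mem_Bsub P hc h1 (by omega) p).eq, mul_assoc _ c,
      ← (commute_arc_of_mem_Bsub P hc (by omega) h2 h1).eq, ← mul_assoc, mul_assoc _ c]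
    exact zpow_mul_arc_mul_mem_arcPairSpan h1 h2 h3 h4
      (mul_mem_arcSpan_Pset hq0 hk (by omega) (Bsub_mono P him hc) h5)
  exact this hw

theorem mul_arc_mul_mem_arcPairSpan (hq0 : P.qc 0 = (P.q0 : R)) (hk : 1 ≤ P.k)
    (hn : m + 2 ≤ P.n - 1) {j g : ℕ} (hi : 1 ≤ i) (hij : i ≤ j) (hjg : j ≤ g)
    {u w : Alg P} (hu : u ∈ Bsub P (g + 1))
    (hw : w ∈ arcSpan P m fun i' p => g ≤ i' ∧ p ∈ Pset P.k) :
    u * arc P i j (m + 3) * w ∈ arcPairSpan P m i := by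
  refine mul_mem_of_arcSpan (fun w hw b hb => arcPairSpan_mul_mem hw hb) ?_ hw
  rintro i' j' p hi' hij' hj' ⟨hg, hp⟩
  have h := arc_mul_Ju_mul_arc P hi hij (hjg.trans hg) hij' (show j' + 1 ≤ m + 1 by omega)
    (by omega) p
  rw [mul_assoc, h, ← mul_assoc, ← mul_assoc,
    ← (commute_Ju_zpow_of_mem_Bsub P hu (by omega) (by omega) p).eq, mul_assoc _ u,
    ← (commute_arc_of_mem_Bsub P hu (by omega) (by omega) (by omega)).eq, ← mul_assoc, mul_assoc _ u]
  refine zpow_mul_arc_mul_mem_arcPairSpan (by omega) (by omega) (by omega) hp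
    (mul_mem_arcSpan_Pset hq0 hk (by omega) (Bsub_mono P (by omega) hu) ?_)
  simpa using zpow_mul_arc_mem_Pset hq0 hk (show m ≤ P.n - 1 by omega) hi hij (by omega) 0

theorem zpow_mul_arc_mul_arc_mem_arcPairSpan (hq0 : P.qc 0 = (P.q0 : R)) (hk : 1 ≤ P.k)
    (hn : m + 2 ≤ P.n - 1) {j g h : ℕ} (hi : 1 ≤ i) (hig : i ≤ g) (hgj : g < j)
    (hj : j ≤ m + 2) (hgh : g ≤ h) (hh : h ≤ m) {r : ℤ} (hr : r ∈ Pset P.k) :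
    ↑(Ju P (g + 1) ^ r) * (arc P i j (m + 3) * arc P g h (m + 1)) ∈ arcPairSpan P m i := by
  have hS : ∀ j, i ≤ j → j ≤ m → arc P i j (m + 1) ∈ arcSpan P m fun _ p => p ∈ Pset P.k :=
    fun j h1 h2 => by
      simpa using zpow_mul_arc_mem_Pset hq0 hk (show m ≤ P.n - 1 by omega) hi h1 h2 0
  rcases le_or_gt (h + 2) j with h' | h'
  · obtain ⟨j, rfl⟩ := Nat.exists_eq_add_of_le' (show 2 ≤ j by omega)
    have e := arc_mul_arc_of_add_two_le P hi hig hgh (show h ≤ j by omega)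
      (show j + 1 ≤ m + 1 by omega) (by omega)
    rw [e, ← mul_assoc]
    exact zpow_mul_arc_mul_mem_arcPairSpan (by omega) (by omega) (by omega) hr
      (hS j (by omega) (by omega))
  · obtain ⟨j, rfl⟩ := Nat.exists_eq_add_of_le' (show 1 ≤ j by omega)
    have e := arc_mul_arc_of_le P hi hig (show g ≤ j by omega) (show j ≤ h by omega)
      (show h + 1 ≤ m + 1 by omega) (by omega)
    rw [e, ← mul_assoc (_ * Xgi P (j + 1)), ← mul_assoc]
    refine mul_mem_arcPairSpan_of_arcSpan hq0 hk hn ?_ (hS j (by omega) (by omega))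
    set N := arcSpan P (m + 2) fun i' p => g + 1 ≤ i' ∧ p = 0
    have hst : ∀ t, g + 1 ≤ t → t ≤ m + 2 → ∀ w ∈ N, Xg P t * w ∈ N ∧ Xgi P t * w ∈ N := by
      intro t h1 h2 w hw
      have := mul_mem_arcSpan_of (C₂ := fun i' p => g + 1 ≤ i' ∧ p = 0) hq0 hk
        (show 1 ≤ t by omega) h2 hn (fun _ _ h => h)
        (fun p s hp hs => by simp only [IsBetweenZero] at hs; omega)
        (fun p s hp hs => by
          rw [hp.2, abs_zero, abs_nonpos_iff] at hs
          exact ⟨h1, hs⟩)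
        (fun p s hp hs => by simp only [IsBetweenZero] at hs; omega)
        (fun i p hit hp => by omega) hw
      exact ⟨this.1, this.2.1⟩
    have hz : seg (Xg P) (g + 1) (j + 1) * Xgi P (j + 1) * arc P (j + 2) (h + 2) (m + 3) ∈ N := by
      rw [mul_assoc]
      have : seg (Xg P) (g + 1) (j + 1) ∈ leftStabilizer N :=
        seg_mem _ fun t h1 h2 w hw => (hst t h1 (by omega) w hw).1
      refine this _ (hst _ (by omega) (by omega) _ ?_).2
      have := zpow_mul_arc_mem (P := P) (p := 0) (l := m + 2)
        (C := fun i' p => g + 1 ≤ i' ∧ p = 0) (show 1 ≤ j + 2 by omega)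
        (show j + 2 ≤ h + 2 by omega) (by omega) ⟨by omega, rfl⟩
      rwa [zpow_zero, Units.val_one, one_mul] at this
    refine mul_mem_of_arcSpan (fun w hw b hb => mul_mem_arcSpan hw hb) ?_ hz
    rintro i' j' _ hi' hij' hj' ⟨h1, rfl⟩
    rw [zpow_zero, Units.val_one, one_mul]
    rcases h1.eq_or_lt with rfl | h1
    · exact zpow_mul_arc_mem hi' hij' hj' ⟨by omega, hr⟩
    · have hb := Ju_zpow_mem_Bsub P (le_refl (g + 1)) r
      rw [← (commute_arc_of_mem_Bsub P hb (by omega) hij' h1).eq]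
      simpa using zpow_mul_arc_mul_mem (p := 0) (l := m + 2)
        (C := fun i' p => i < i' ∧ p ∈ Pset P.k) hi' hij' hj' ⟨by omega, zero_mem_Pset hk⟩
        (Bsub_mono P (show g + 1 ≤ m + 1 by omega) hb)

theorem arc_mul_zpow_mul_arc_mem_arcPairSpan (hq0 : P.qc 0 = (P.q0 : R)) (hk : 1 ≤ P.k)
    (hn : m + 2 ≤ P.n - 1) {j g h : ℕ} (hi : 1 ≤ i) (hig : i ≤ g) (hgj : g < j)
    (hj : j ≤ m + 2) (hgh : g ≤ h) (hh : h ≤ m) {r : ℤ} (hr : r ∈ Pset P.k) :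
    arc P i j (m + 3) * (↑(Ju P g ^ r) * arc P g h (m + 1)) ∈ arcPairSpan P m i := by
  have hg : 1 ≤ g := hi.trans hig
  have H := isRankTwo P hg (by omega)
  set c := seg (Xg P) i g with hc
  set v := arc P (g + 1) j (m + 3) with hv
  set w := arc P g h (m + 1) with hw
  have hcB : c ∈ Bsub P g := seg_Xg_mem_Bsub le_rfl
  have hcb : ∀ s : ℤ, c * ↑(Ju P (g + 1) ^ s) = ↑(Ju P (g + 1) ^ s) * c := fun s =>
    (commute_Ju_zpow_of_mem_Bsub P hcB le_rfl (by omega) s).eq.symm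
  have hD : arc P i j (m + 3) = c * Xg P g * v := by
    rw [mul_assoc, hv, Xg_mul_arc hgj, arc, arc, ← mul_assoc, seg_mul_seg _ hig hgj.le]
  have hvd : ∀ d ∈ Bsub P g, v * d = d * v := fun d hd =>
    (commute_arc_of_mem_Bsub P hd (by omega) hgj le_rfl).eq
  have hav : ∀ q : ℤ, ↑(Ju P g ^ q) * v = v * ↑(Ju P g ^ q) := fun q =>
    (hvd _ (Ju_zpow_mem_Bsub P le_rfl q)).symm
  have h0 : ∀ s ∈ Pset P.k, c * ↑(Ju P (g + 1) ^ s) * Xg P g * (v * w) ∈ arcPairSpan P m i := by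
    intro s hs
    have := zpow_mul_arc_mul_arc_mem_arcPairSpan hq0 hk hn hi hig hgj hj hgh hh hs
    rw [hD] at this
    rw [hcb]
    simpa only [mul_assoc] using this
  have h1 : ∀ s ∈ Pset P.k, ∀ q : ℤ,
      c * ↑(Ju P (g + 1) ^ s) * ↑(Ju P g ^ q) * (v * w) ∈ arcPairSpan P m i := by
    intro s hs q
    have hd : c * ↑(Ju P g ^ q) ∈ Bsub P g := mul_mem hcB (Ju_zpow_mem_Bsub P le_rfl q)
    have e : c * ↑(Ju P (g + 1) ^ s) * ↑(Ju P g ^ q) * (v * w)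
        = ↑(Ju P (g + 1) ^ s) * v * (c * ↑(Ju P g ^ q) * w) := by
      rw [mul_assoc _ v, ← mul_assoc v, hvd _ hd, hcb]
      simp only [mul_assoc]
    rw [e]
    refine zpow_mul_arc_mul_mem_arcPairSpan (by omega) hgj hj hs
      (mul_mem_arcSpan_Pset hq0 hk (by omega) (Bsub_mono P (by omega) hd) ?_)
    simpa using zpow_mul_arc_mem_Pset hq0 hk (show m ≤ P.n - 1 by omega) hg hgh hh 0
  have h2 : ∀ s q : ℤ, (∀ d : ℤ, |d| ≤ |q| → d ∈ Pset P.k) →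
      c * ↑(Ju P (g + 1) ^ s) * Eg P g * ↑(Ju P g ^ q) * (v * w) ∈ arcPairSpan P m i := by
    intro s q hq
    obtain ⟨y, hy, hyv⟩ := Eg_mul_arc P hg hgj hj hn
    set N := arcSpan P m fun i' p => g ≤ i' ∧ |p| ≤ |q|
    have hyN : y ∈ leftStabilizer N := by
      refine (Submonoid.closure_le (S := leftStabilizer N)).2 ?_ hy
      rintro _ ⟨t, ht, ht', rfl⟩ w hw
      exact (mul_mem_arcSpan_of (C₂ := fun i' p => g ≤ i' ∧ |p| ≤ |q|) hq0 hk
        (show 1 ≤ t by omega) (by omega) (by omega) (fun _ _ h => h)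
        (fun p s hp hs => by
          have : |s| ≤ |q| := (by rcases hs with hs | hs <;> grind : |s| ≤ |p|).trans hp.2
          exact ⟨⟨ht, this⟩, by omega, this⟩)
        (fun p s hp hs => ⟨ht, hs.trans hp.2⟩)
        (fun p s hp hs => ⟨by omega,
          (by rcases hs with hs | hs <;> grind : |s| ≤ |p|).trans hp.2⟩)
        (fun i p hit hp => ⟨ht, by simp⟩) hw).2.1
    have e : c * ↑(Ju P (g + 1) ^ s) * Eg P g * ↑(Ju P g ^ q) * (v * w)
        = ↑(Ju P (g + 1) ^ s) * arc P i g (m + 3) * (y * (↑(Ju P g ^ q) * w)) := by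
      rw [← mul_assoc _ v, mul_assoc _ _ v, hav, ← mul_assoc _ v, mul_assoc _ _ v, hv, hyv, hcb, arc]
      simp only [mul_assoc]
      rfl
    rw [e]
    refine mul_arc_mul_mem_arcPairSpan hq0 hk hn hi hig le_rfl (Ju_zpow_mem_Bsub P le_rfl s)
      (arcSpan_mono (fun i' p _ _ hp => ⟨hp.1, hq p hp.2⟩) (hyN _ ?_))
    exact zpow_mul_arc_mem hg hgh hh ⟨le_rfl, le_rfl⟩
  have key : c * Xg P g * ↑(Ju P g ^ r) * (v * w) ∈ arcPairSpan P m i := by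
    obtain ⟨d, rfl | rfl⟩ := r.eq_nat_or_neg
    · rw [zpow_natCast]
      refine H.x_mul_a_pow_mem _ ?_ ?_ ?_
      · rw [← zpow_natCast]
        exact h0 _ hr
      · intro s q hs hsq
        rw [← zpow_natCast, ← zpow_natCast]
        exact h1 _ ⟨by have := hr.1; omega, by have := hr.2; omega⟩ _
      · intro s q hs hsq
        rw [← zpow_natCast, ← zpow_natCast]
        refine h2 _ _ fun d' hd' => ?_
        rw [abs_le, Nat.abs_cast] at hd'
        obtain ⟨hr1, hr2⟩ := hr
        exact ⟨by omega, by omega⟩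
    · have hr' : ∀ d' : ℤ, |d'| ≤ d → d' ∈ Pset P.k := fun d' hd' => by
        rw [abs_le] at hd'
        obtain ⟨hr1, hr2⟩ := hr
        exact ⟨by omega, by omega⟩
      have hz := zero_mem_Pset hk
      have e : c * Xg P g * ↑(Ju P g ^ (-(d : ℤ))) * (v * w)
          = c * Xg P g * (↑(Ju P g ^ (-(d : ℤ))) * (v * w)) := mul_assoc _ _ _
      rw [e]
      refine H.mul_x_mem _ ?_ ?_ ?_
      · have := H.inv.x_mul_a_pow_mem (arcPairSpan P m i) (u := c) (v := v * w) (p := d) ?_ ?_ ?_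
        · rwa [mul_assoc, inv_pow, ← zpow_natCast, ← zpow_neg] at this
        · rw [inv_pow, ← zpow_natCast, ← zpow_neg]
          refine H.mul_xinv_mem _ (h0 _ hr) ?_ ?_
          · simpa using h1 _ hr 0
          · simpa using h2 (-d) 0 fun d' hd' => hr' d' (hd'.trans (by simp))
        · intro s q hs hsq
          rw [inv_pow, ← zpow_natCast, ← zpow_neg, inv_pow, ← zpow_natCast, ← zpow_neg]
          exact h1 _ (hr' _ (by rw [abs_neg, Nat.abs_cast]; omega)) _
        · intro s q hs hsq
          rw [inv_pow, ← zpow_natCast, ← zpow_neg, inv_pow, ← zpow_natCast, ← zpow_neg]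
          refine h2 _ _ fun d' hd' => hr' _ (hd'.trans ?_)
          rw [abs_neg, Nat.abs_cast]
          omega
      · simpa [mul_assoc] using h1 0 hz (-d)
      · have := h2 0 (-d) fun d' hd' => hr' _ (by simpa using hd')
        simpa [mul_assoc] using this
  rw [hD, mul_assoc _ v, ← mul_assoc v, ← hav, mul_assoc _ v, ← mul_assoc (c * Xg P g)]
  exact key

end CBMW

/-- Lemma 9 of the paper. Reordering of two `α`-chains:
if `i ≤ g` and `p, r ∈ P` then `α_{ijl}^p α_{g,h,l-2}^r` lies in the span of the
`α_{i'j'l}^{p'} α_{g'h'l-2}^{r'} B_{l-3}` with `i' > i` and `p', r' ∈ P`. -/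
theorem statement8 {R : Type} [CommRing R] (P : Params R)
    (hn : 1 ≤ P.n) (hk : 1 ≤ P.k) (hq0 : P.qc 0 = (P.q0 : R))
    (hcomp : (P.lam : R) - P.laminv = P.delta * (1 - P.A 0))
    (i j g h l : ℕ) (p r : ℤ)
    (hl3 : 3 ≤ l) (hl : l ≤ P.n - 1)
    (hi : 1 ≤ i) (hij : i ≤ j) (hjl : j ≤ l)
    (hg : 1 ≤ g) (hgh : g ≤ h) (hhl : h ≤ l - 2)
    (hig : i ≤ g) (hp : p ∈ Pset P.k) (hr : r ∈ Pset P.k) :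
    alpha P i j l p * alpha P g h (l - 2) r ∈
      Submodule.span R
        {x : Alg P | ∃ (i' j' g' h' : ℕ) (p' r' : ℤ) (b : Alg P),
          i < i' ∧ 1 ≤ i' ∧ i' ≤ j' ∧ j' ≤ l ∧
          1 ≤ g' ∧ g' ≤ h' ∧ h' ≤ l - 2 ∧
          p' ∈ Pset P.k ∧ r' ∈ Pset P.k ∧ b ∈ Bsub P (l - 3) ∧
          x = alpha P i' j' l p' * alpha P g' h' (l - 2) r' * b} := by
  obtain ⟨m, rfl⟩ := Nat.exists_eq_add_of_le' (show 2 ≤ l by omega)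
  simp only [Nat.add_sub_cancel] at hhl ⊢
  have key : alpha P i j (m + 2) p * alpha P g h m r ∈ arcPairSpan P m i := by
    rw [alpha_eq P hi, alpha_eq P hg, mul_assoc]
    refine mul_mem_arcPairSpan hq0 hk hl hi (by omega) (Ju_zpow_mem_Bsub P le_rfl p) ?_
    rcases le_or_gt j g with hjg | hgj
    · have := mul_arc_mul_mem_arcPairSpan hq0 hk hl hi hij hjg (one_mem _)
        (zpow_mul_arc_mem (C := fun i' p => g ≤ i' ∧ p ∈ Pset P.k) hg hgh hhl ⟨le_rfl, hr⟩)
      rwa [one_mul] at this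
    · exact arc_mul_zpow_mul_arc_mem_arcPairSpan hq0 hk hl hi hig hgj hjl hgh hhl hr
  refine (Submodule.span_le.2 ?_) key
  rintro _ ⟨i', j', p', w, h1, h2, h3, h4, h5, rfl⟩
  refine mul_mem_of_arcSpan (fun w hw b hb => ?_) (fun g' h' r' k1 k2 k3 k4 => ?_) h5
  · refine mul_mem_span_of_forall_mul_mem ?_ hw
    rintro _ ⟨i', j', g', h', p', r', b', k1, k2, k3, k4, k5, k6, k7, k8, k9, k10, rfl⟩
    rw [mul_assoc]
    exact Submodule.subset_span
      ⟨i', j', g', h', p', r', _, k1, k2, k3, k4, k5, k6, k7, k8, k9, mul_mem k10 hb, rfl⟩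
  · refine Submodule.subset_span
      ⟨i', j', g', h', p', r', 1, h1, by omega, h2, h3, k1, k2, k3, h4, k4, one_mem _, ?_⟩
    rw [mul_one, alpha_eq P (by omega), alpha_eq P k1]
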